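/- arXiv:1509.04346 — 8 statements merged into one kernel-verified Lean document; each statement's English description precedes it below -/
import Mathlib

section
/- Let M be an ultrametric space, n a non-negative integer, and F, F' two n-element subsets of M. A map φ : F → F' extends to a surjective isometry of M onto itself if and only if (1) φ is an isometry from the subspace induced on F onto the subspace induced on F', and (2) for each x ∈ F there exists a surjective isometry of M onto itself mapping x to φ(x). -/
section UltrametricIsometry

variable {M : Type*} [MetricSpace M] [IsUltrametricDist M]

theorem IsUltrametricDist.dist_eq_of_dist_le {x y z : M} {r : ℝ} (hxz : dist x z ≤ r)
    (hxy : r ≤ dist x y) (hzy : r ≤ dist z y) : dist z y = dist x y :=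
  le_antisymm
    ((dist_triangle_max z x y).trans (max_le (dist_comm z x ▸ hxz.trans hxy) le_rfl))
    ((dist_triangle_max x z y).trans (max_le (hxz.trans hzy) le_rfl))

theorem IsUltrametricDist.le_dist_of_dist_lt {x y c : M} {r : ℝ} (hx : dist x c < r)
    (hy : r ≤ dist y c) : r ≤ dist x y := by
  by_contra! h
  have := dist_triangle_max y x c
  rw [dist_comm y x] at this
  exact absurd (this.trans_lt (max_lt h hx)) (not_lt.2 hy)

open IsUltrametricDist (dist_eq_of_dist_le le_dist_of_dist_lt)

/-- An isometry preserving a ball can be replaced by the identity outside of it. -/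
theorem IsometryEquiv.exists_eq_self_off_ball (k : M ≃ᵢ M) {a : M} {r : ℝ}
    (hr : dist a (k a) < r) :
    ∃ h : M ≃ᵢ M, h a = k a ∧ ∀ x, r ≤ dist x a → h x = x := by
  classical
  have hr0 : 0 < r := dist_nonneg.trans_lt hr
  have hk : ∀ x, dist x a < r → dist (k x) a < r := fun x hx => by
    refine (dist_triangle_max (k x) (k a) a).trans_lt (max_lt ?_ (dist_comm a (k a) ▸ hr))
    rwa [k.dist_eq]
  have hks : ∀ x, dist x a < r → dist (k.symm x) a < r := fun x hx => by
    rw [← k.dist_eq, k.apply_symm_apply]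
    exact (dist_triangle_max x a (k a)).trans_lt (max_lt hx hr)
  have key : ∀ x y, dist x a < r → r ≤ dist y a → dist (k x) y = dist x y := fun x y hx hy => by
    refine dist_eq_of_dist_le (r := r) ?_ (le_dist_of_dist_lt hx hy)
      (le_dist_of_dist_lt (hk x hx) hy)
    exact (dist_triangle_max x a (k x)).trans (max_le hx.le (dist_comm a (k x) ▸ (hk x hx).le))
  refine ⟨IsometryEquiv.mk' (fun x => if dist x a < r then k x else x)
    (fun x => if dist x a < r then k.symm x else x) (fun x => ?_)
    (Isometry.of_dist_eq fun x y => ?_), ?_, fun x hx => ?_⟩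
  · by_cases hx : dist x a < r
    · simp [hx, hks x hx]
    · simp [hx]
  · by_cases hx : dist x a < r <;> by_cases hy : dist y a < r
    · simp only [if_pos hx, if_pos hy, k.dist_eq]
    · simpa [hx, hy] using key x y hx (not_lt.1 hy)
    · rw [if_neg hx, if_pos hy, dist_comm, key y x hy (not_lt.1 hx), dist_comm]
    · simp [hx, hy]
  · change (if dist a a < r then k a else a) = k a
    simp [hr0]
  · change (if dist x a < r then k x else x) = x
    simp [hx]

/-- An isometry moving a ball onto a disjoint one can be replaced by an involution that exchanges
both balls and is the identity elsewhere. -/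
theorem IsometryEquiv.exists_swap_ball (k : M ≃ᵢ M) {a : M} (ha : 0 < dist a (k a)) :
    ∃ h : M ≃ᵢ M, h a = k a ∧
      ∀ x, dist a (k a) ≤ dist x a → dist a (k a) ≤ dist x (k a) → h x = x := by
  classical
  obtain ⟨b, hb⟩ : ∃ b, b = k a := ⟨_, rfl⟩
  obtain ⟨r, hr⟩ : ∃ r, r = dist a b := ⟨_, rfl⟩
  rw [← hb, ← hr] at ha ⊢
  have hk : ∀ x, dist x a < r → dist (k x) b < r := fun x hx => by
    rwa [hb, k.dist_eq]
  have hks : ∀ x, dist x b < r → dist (k.symm x) a < r := fun x hx => by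
    rwa [← k.dist_eq, k.apply_symm_apply, ← hb]
  have disj : ∀ x, dist x b < r → ¬ dist x a < r := fun x hxb hxa => by
    have := dist_triangle_max a x b
    rw [dist_comm a x, ← hr] at this
    exact absurd (this.trans_lt (max_lt hxa hxb)) (lt_irrefl r)
  have cross : ∀ x y, dist x a < r → dist y b < r → dist x y = r := fun x y hx hy => by
    refine le_antisymm ?_ (le_dist_of_dist_lt hx (not_lt.1 (disj y hy)))
    refine (dist_triangle_max x a y).trans (max_le hx.le ((dist_triangle_max a b y).trans ?_))
    exact max_le hr.ge (dist_comm b y ▸ hy.le)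
  have keyA : ∀ x y, dist x a < r → r ≤ dist y a → r ≤ dist y b → dist (k x) y = dist x y :=
    fun x y hx hya hyb => dist_eq_of_dist_le (cross x _ hx (hk x hx)).le
      (le_dist_of_dist_lt hx hya) (le_dist_of_dist_lt (hk x hx) hyb)
  have keyB : ∀ x y, dist x b < r → r ≤ dist y a → r ≤ dist y b → dist (k.symm x) y = dist x y :=
    fun x y hx hya hyb => dist_eq_of_dist_le
      (dist_comm x (k.symm x) ▸ (cross _ x (hks x hx) hx).le)
      (le_dist_of_dist_lt hx hyb) (le_dist_of_dist_lt (hks x hx) hya)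
  let f : M → M := fun x => if dist x a < r then k x else if dist x b < r then k.symm x else x
  have fA : ∀ x, dist x a < r → f x = k x := fun x hx => if_pos hx
  have fB : ∀ x, dist x b < r → f x = k.symm x := fun x hx => by
    simp [f, hx, disj x hx]
  have fC : ∀ x, r ≤ dist x a → r ≤ dist x b → f x = x := fun x hxa hxb => by
    simp [f, hxa.not_gt, hxb.not_gt]
  have trichotomy : ∀ x, dist x a < r ∨ dist x b < r ∨ (r ≤ dist x a ∧ r ≤ dist x b) := fun x => by
    grind
  refine ⟨IsometryEquiv.mk' f f (fun x => ?_) (Isometry.of_dist_eq fun x y => ?_),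
    fA a (by rwa [dist_self]) |>.trans hb.symm, fC⟩
  · rcases trichotomy x with hx | hx | ⟨hxa, hxb⟩
    · rw [fA x hx, fB _ (hk x hx), k.symm_apply_apply]
    · rw [fB x hx, fA _ (hks x hx), k.apply_symm_apply]
    · rw [fC x hxa hxb, fC x hxa hxb]
  · rcases trichotomy x with hx | hx | ⟨hxa, hxb⟩ <;> rcases trichotomy y with hy | hy | ⟨hya, hyb⟩
    · rw [fA x hx, fA y hy, k.dist_eq]
    · rw [fA x hx, fB y hy, cross x y hx hy, dist_comm, cross _ _ (hks y hy) (hk x hx)]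
    · rw [fA x hx, fC y hya hyb, keyA x y hx hya hyb]
    · rw [fB x hx, fA y hy, dist_comm x y, cross y x hy hx, cross _ _ (hks x hx) (hk y hy)]
    · rw [fB x hx, fB y hy, k.symm.dist_eq]
    · rw [fB x hx, fC y hya hyb, keyB x y hx hya hyb]
    · rw [fC x hxa hxb, fA y hy, dist_comm, keyA y x hy hxa hxb, dist_comm]
    · rw [fC x hxa hxb, fB y hy, dist_comm, keyB y x hy hxa hxb, dist_comm]
    · rw [fC x hxa hxb, fC y hya hyb]

theorem IsometryEquiv.exists_fixing_of_dist_eq (k : M ≃ᵢ M) {a : M} {S : Set M} (hS : S.Finite)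
    (ha : a ∉ S) (hdist : ∀ s ∈ S, dist s (k a) = dist s a) :
    ∃ h : M ≃ᵢ M, h a = k a ∧ ∀ s ∈ S, h s = s := by
  rcases S.eq_empty_or_nonempty with rfl | hne
  · exact ⟨k, rfl, by simp⟩
  obtain ⟨s, hs, hmin⟩ := Set.exists_min_image S (fun s => dist s a) hS hne
  have hle : dist a (k a) ≤ dist s a :=
    (dist_triangle_max a s (k a)).trans (max_le (dist_comm a s).le (hdist s hs).le)
  rcases hle.lt_or_eq with hlt | heq
  · obtain ⟨h, hha, hh⟩ := k.exists_eq_self_off_ball hlt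
    exact ⟨h, hha, fun t ht => hh t (hmin t ht)⟩
  · have hpos : 0 < dist s a := dist_pos.2 (ne_of_mem_of_not_mem hs ha)
    obtain ⟨h, hha, hh⟩ := k.exists_swap_ball (heq ▸ hpos)
    refine ⟨h, hha, fun t ht => hh t (heq ▸ hmin t ht) ?_⟩
    rw [hdist t ht, heq]
    exact hmin t ht

/-- In an ultrametric space, a distance-preserving map on a finite set extends to a
self-isometry of the whole space as soon as its restriction to each point does. -/
theorem Set.Finite.exists_isometryEquiv_extension {F : Set M} (hF : F.Finite) {φ : M → M}
    (hφ : ∀ x ∈ F, ∀ y ∈ F, dist (φ x) (φ y) = dist x y)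
    (hpt : ∀ x ∈ F, ∃ ψ : M ≃ᵢ M, ψ x = φ x) :
    ∃ ψ : M ≃ᵢ M, ∀ x ∈ F, ψ x = φ x := by
  induction F, hF using Set.Finite.induction_on with
  | empty => exact ⟨IsometryEquiv.refl M, by simp⟩
  | @insert a S haS hS ih =>
    obtain ⟨g, hg⟩ := ih
      (fun x hx y hy => hφ x (Set.mem_insert_of_mem a hx) y (Set.mem_insert_of_mem a hy))
      (fun x hx => hpt x (Set.mem_insert_of_mem a hx))
    obtain ⟨k, hk⟩ := hpt a (Set.mem_insert a S)
    obtain ⟨h, hha, hhS⟩ := (k.trans g.symm).exists_fixing_of_dist_eq hS haS fun s hs => by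
      rw [← g.dist_eq]
      simpa [hk, hg s hs] using hφ s (Set.mem_insert_of_mem a hs) a (Set.mem_insert a S)
    refine ⟨h.trans g, ?_⟩
    rintro x (rfl | hx)
    · simp [hha, hk]
    · simp [hhS x hx, hg x hx]

end UltrametricIsometry

/-- Let `M` be an ultrametric space, `n` a non-negative integer, and
`F`, `F'` two `n`-element subsets of `M`.  A map `φ : F → F'` extends to a surjective
isometry of `M` onto itself if and only if (1) `φ` is an isometry from the subspace
induced on `F` onto the subspace induced on `F'`, and (2) for each `x ∈ F` there is a
surjective isometry of `M` onto itself mapping `x` to `φ x`. -/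
theorem stmt0 {M : Type*} [MetricSpace M]
    (ultra : ∀ x y z : M, dist x z ≤ max (dist x y) (dist y z))
    (n : ℕ) (F F' : Set M) (hFfin : F.Finite) (hF'fin : F'.Finite)
    (hFcard : F.ncard = n) (hF'card : F'.ncard = n)
    (φ : M → M) (hmaps : Set.MapsTo φ F F') :
    (∃ ψ : M ≃ᵢ M, ∀ x ∈ F, ψ x = φ x) ↔
      ((∀ x ∈ F, ∀ y ∈ F, dist (φ x) (φ y) = dist x y) ∧ φ '' F = F') ∧
        (∀ x ∈ F, ∃ ψ : M ≃ᵢ M, ψ x = φ x) := by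
  have : IsUltrametricDist M := ⟨ultra⟩
  constructor
  · rintro ⟨ψ, hψ⟩
    refine ⟨⟨fun x hx y hy => ?_, ?_⟩, fun x hx => ⟨ψ, hψ x hx⟩⟩
    · rw [← hψ x hx, ← hψ y hy, ψ.dist_eq]
    · have hinj : Set.InjOn φ F := ψ.injective.injOn.congr hψ
      exact Set.eq_of_subset_of_ncard_le hmaps.image_subset
        (by rw [hinj.ncard_image, hFcard, hF'card]) hF'fin
  · rintro ⟨⟨hφ, -⟩, hpt⟩
    exact hFfin.exists_isometryEquiv_extension hφ hpt
end

section
/- Let M be an ultrametric space, n a non-negative integer, and F, F' two n-element subsets of M. A map φ : F → F' extends to a surjective isometry of M onto itself if and only if for every pair x, y ∈ F there exists a surjective isometry of M onto itself mapping x to φ(x) and y to φ(y). -/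
open Classical in
/-- Apply `g` on the ball of radius `r` about `a`, its inverse on the rest of the ball of radius
`r` about `b`, and the identity elsewhere. -/
noncomputable def ballExchange {M : Type*} [MetricSpace M] (g : M ≃ᵢ M) (a b : M) (r : ℝ)
    (u : M) : M :=
  if dist u a < r then g u else if dist u b < r then g.symm u else u

section

variable {M : Type*} [MetricSpace M] {g : M ≃ᵢ M} {a b : M} {r : ℝ}

theorem dist_apply_of_apply_eq (hg : g a = b) (u : M) : dist (g u) b = dist u a := by
  rw [← hg, g.dist_eq]

theorem dist_symm_apply_of_apply_eq (hg : g a = b) (u : M) :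
    dist (g.symm u) a = dist u b := by
  rw [← g.dist_eq, g.apply_symm_apply, hg]

variable [IsUltrametricDist M]

theorem dist_lt_of_dist_lt_of_dist_lt {x y z : M} (hxy : dist x y < r) (hyz : dist y z < r) :
    dist x z < r :=
  (dist_triangle_max x y z).trans_lt (max_lt hxy hyz)

theorem dist_le_of_dist_le_of_dist_le {x y z : M} (hxy : dist x y ≤ r) (hyz : dist y z ≤ r) :
    dist x z ≤ r :=
  (dist_triangle_max x y z).trans (max_le hxy hyz)

theorem ballExchange_symm_ballExchange (hg : g a = b) (u : M) :
    ballExchange g.symm b a r (ballExchange g a b r u) = u := by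
  unfold ballExchange
  by_cases hua : dist u a < r
  · simp [hua, dist_apply_of_apply_eq hg]
  · by_cases hub : dist u b < r
    · have hball : ¬ dist (g.symm u) b < r := fun h => hua <|
        dist_lt_of_dist_lt_of_dist_lt (dist_lt_of_dist_lt_of_dist_lt hub (dist_comm _ b ▸ h))
          ((dist_symm_apply_of_apply_eq hg u).trans_lt hub)
      simp [hua, hub, hball, dist_symm_apply_of_apply_eq hg]
    · simp [hua, hub]

theorem dist_ballExchange_self_le (hg : g a = b) (hab : dist a b ≤ r) (hr : 0 ≤ r) (u : M) :
    dist (ballExchange g a b r u) u ≤ r := by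
  unfold ballExchange
  split_ifs with hua hub
  · refine dist_le_of_dist_le_of_dist_le ((dist_apply_of_apply_eq hg u).trans_le hua.le) ?_
    exact dist_le_of_dist_le_of_dist_le (dist_comm a b ▸ hab) (dist_comm u a ▸ hua.le)
  · refine dist_le_of_dist_le_of_dist_le ((dist_symm_apply_of_apply_eq hg u).trans_le hub.le) ?_
    exact dist_le_of_dist_le_of_dist_le hab (dist_comm u b ▸ hub.le)
  · simpa using hr

theorem dist_ballExchange_le (hg : g a = b) (hab : dist a b ≤ r) (hr : 0 ≤ r) (u v : M) :
    dist (ballExchange g a b r u) (ballExchange g a b r v) ≤ dist u v := by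
  rcases lt_or_ge (dist u v) r with huv | huv
  · have hiff (c : M) : dist u c < r ↔ dist v c < r :=
      ⟨dist_lt_of_dist_lt_of_dist_lt (dist_comm u v ▸ huv), dist_lt_of_dist_lt_of_dist_lt huv⟩
    unfold ballExchange
    simp only [hiff]
    split_ifs <;> simp [IsometryEquiv.dist_eq]
  · refine dist_le_of_dist_le_of_dist_le
      ((dist_ballExchange_self_le hg hab hr u).trans huv) ?_
    refine dist_le_of_dist_le_of_dist_le le_rfl ?_
    rw [dist_comm]
    exact (dist_ballExchange_self_le hg hab hr v).trans huv

/-- In an ultrametric space, if `b` is in the orbit of `a` under the isometry group and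
`dist a b ≤ r`, then some isometry carries `a` to `b` and fixes every point at distance at least
`r` from both. -/
theorem exists_isometryEquiv_apply_eq_fixing_far (hg : g a = b) (hab : dist a b ≤ r)
    (hr : 0 < r) :
    ∃ h : M ≃ᵢ M, h a = b ∧ ∀ v, r ≤ dist v a → r ≤ dist v b → h v = v := by
  have hg' : g.symm b = a := by rw [← hg, g.symm_apply_apply]
  have hleft := ballExchange_symm_ballExchange (r := r) hg
  refine ⟨⟨⟨ballExchange g a b r, ballExchange g.symm b a r, hleft, fun u => ?_⟩,
    Isometry.of_dist_eq fun u v => le_antisymm (dist_ballExchange_le hg hab hr.le u v) ?_⟩,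
    ?_, fun v hva hvb => ?_⟩
  · exact ballExchange_symm_ballExchange hg' u
  · have h := dist_ballExchange_le hg' (dist_comm a b ▸ hab) hr.le
      (ballExchange g a b r u) (ballExchange g a b r v)
    rwa [hleft, hleft] at h
  · change ballExchange g a b r a = b
    simp [ballExchange, hr, hg]
  · change ballExchange g a b r v = v
    simp [ballExchange, hva.not_gt, hvb.not_gt]

theorem exists_isometryEquiv_extending_of_pairwise {F : Set M} (hF : F.Finite) (φ : M → M)
    (hpair : ∀ x ∈ F, ∀ y ∈ F, ∃ ψ : M ≃ᵢ M, ψ x = φ x ∧ ψ y = φ y) :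
    ∃ ψ : M ≃ᵢ M, ∀ x ∈ F, ψ x = φ x := by
  induction F, hF using Set.Finite.induction_on with
  | empty => exact ⟨IsometryEquiv.refl M, by simp⟩
  | @insert a F haF hF ih =>
    have haI : a ∈ insert a F := Set.mem_insert a F
    have hI {y : M} (hy : y ∈ F) : y ∈ insert a F := Set.mem_insert_of_mem a hy
    obtain ⟨ψ, hψ⟩ := ih fun x hx y hy => hpair x (hI hx) y (hI hy)
    rcases F.eq_empty_or_nonempty with rfl | hne
    · obtain ⟨χ, hχ, -⟩ := hpair a haI a haI
      exact ⟨χ, by simpa using hχ⟩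
    obtain ⟨x, hx, hmin⟩ := F.exists_min_image (dist · a) hF hne
    have hφ {y : M} (hy : y ∈ F) : dist (φ y) (φ a) = dist y a := by
      obtain ⟨χ, hy', ha'⟩ := hpair y (hI hy) a haI
      rw [← hy', ← ha', χ.dist_eq]
    obtain ⟨χ, -, hχa⟩ := hpair x (hI hx) a haI
    have hdist : dist (ψ a) (φ a) ≤ dist x a := by
      refine dist_le_of_dist_le_of_dist_le (y := φ x) ?_ (hφ hx).le
      rw [← hψ x hx, ψ.dist_eq, dist_comm]
    obtain ⟨h, hha, hfix⟩ := exists_isometryEquiv_apply_eq_fixing_far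
      (g := ψ.symm.trans χ) (a := ψ a) (b := φ a) (by simpa using hχa) hdist
      (dist_pos.2 fun hxa => haF (hxa ▸ hx))
    refine ⟨ψ.trans h, fun y hy => ?_⟩
    rcases hy with rfl | hy
    · exact hha
    · rw [IsometryEquiv.trans_apply, hψ y hy]
      apply hfix
      · rw [← hψ y hy, ψ.dist_eq]
        exact hmin y hy
      · rw [hφ hy]
        exact hmin y hy

end

/-- Let `M` be an ultrametric space, `n` a non-negative integer, and
`F`, `F'` two `n`-element subsets of `M`.  A map `φ : F → F'` extends to a surjective
isometry of `M` onto itself if and only if for every pair `x, y ∈ F` there exists a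
surjective isometry of `M` onto itself mapping `x` to `φ x` and `y` to `φ y`. -/
theorem stmt1 {M : Type*} [MetricSpace M]
    (ultra : ∀ x y z : M, dist x z ≤ max (dist x y) (dist y z))
    (n : ℕ) (F F' : Set M) (hFfin : F.Finite) (hF'fin : F'.Finite)
    (hFcard : F.ncard = n) (hF'card : F'.ncard = n)
    (φ : M → M) (hmaps : Set.MapsTo φ F F') :
    (∃ ψ : M ≃ᵢ M, ∀ x ∈ F, ψ x = φ x) ↔
      ∀ x ∈ F, ∀ y ∈ F, ∃ ψ : M ≃ᵢ M, ψ x = φ x ∧ ψ y = φ y := by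
  have : IsUltrametricDist M := ⟨ultra⟩
  constructor
  · rintro ⟨ψ, hψ⟩ x hx y hy
    exact ⟨ψ, hψ x hx, hψ y hy⟩
  · exact exists_isometryEquiv_extending_of_pairwise hFfin φ
end

section
/- An ultrametric space M is homogeneous if and only if its group of surjective self-isometries acts transitively on M, i.e., for all x, x' ∈ M there exists a surjective isometry of M onto itself mapping x to x'. -/
/-- A metric space is homogeneous if every isometry between two finite subsets of it
extends to a surjective isometry of the whole space onto itself. -/
def IsHomogeneous (M : Type*) [MetricSpace M] : Prop :=
  ∀ F : Set M, F.Finite → ∀ φ : M → M,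
    (∀ x ∈ F, ∀ y ∈ F, dist (φ x) (φ y) = dist x y) →
    ∃ ψ : M ≃ᵢ M, ∀ x ∈ F, ψ x = φ x

section Ultrametric

variable {M : Type*} [MetricSpace M]

/-- All triangles are isosceles in an ultrametric space. -/
theorem dist_eq_of_dist_lt_of_ultra
    (ultra : ∀ x y z : M, dist x z ≤ max (dist x y) (dist y z))
    {p q s : M} (h : dist p q < dist q s) : dist p s = dist q s := by
  have h₁ := ultra p q s
  have h₂ := ultra q p s
  rw [dist_comm q p] at h₂
  grind

/-- If an isometry of an ultrametric space maps `b` to `c`, then some isometry maps `b` to `c`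
and fixes every point whose distances to `b` and `c` are both at least `dist b c`. -/
theorem exists_isometryEquiv_fixing_far_points
    (ultra : ∀ x y z : M, dist x z ≤ max (dist x y) (dist y z))
    {b c : M} (h : M ≃ᵢ M) (hbc : h b = c) :
    ∃ g : M ≃ᵢ M, g b = c ∧ ∀ y, dist b c ≤ dist y b → dist b c ≤ dist y c → g y = y := by
  classical
  rcases eq_or_ne b c with rfl | hne
  · exact ⟨IsometryEquiv.refl M, rfl, fun _ _ _ => rfl⟩
  have hpos : 0 < dist b c := dist_pos.2 hne
  set r := dist b c with hr
  have hball : ∀ x, dist (h x) c = dist x b := fun x => by rw [← hbc, h.dist_eq]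
  have hball_symm : ∀ x, dist (h.symm x) b = dist x c := fun x => by
    rw [← hball, h.apply_symm_apply]
  have disj : ∀ x, dist x b < r → ¬ dist x c < r := fun x h₁ h₂ => by
    have := ultra b x c
    rw [dist_comm b x] at this
    grind
  have cross : ∀ x y, dist x b < r → dist y c < r → dist x y = r := fun x y hx hy => by
    have e₁ : dist x c = r := dist_eq_of_dist_lt_of_ultra ultra hx
    have e₂ : dist y x = dist c x :=
      dist_eq_of_dist_lt_of_ultra ultra (by rw [dist_comm c x, e₁]; exact hy)
    rw [dist_comm x y, e₂, dist_comm c x, e₁]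
  have far : ∀ y, ¬ dist y b < r → ¬ dist y c < r → dist b y = dist c y := fun y hb hc => by
    have h₁ := ultra b c y
    have h₂ := ultra c b y
    rw [dist_comm c b] at h₂
    rw [dist_comm y b] at hb
    rw [dist_comm y c] at hc
    grind
  have near : ∀ x y z, dist x z < r → ¬ dist y z < r → dist x y = dist z y :=
    fun x y z hx hy => dist_eq_of_dist_lt_of_ultra ultra
      (by rw [dist_comm z y]; exact hx.trans_le (not_lt.1 hy))
  let g : M → M := fun x => if dist x b < r then h x else if dist x c < r then h.symm x else x
  have g_of_b : ∀ x, dist x b < r → g x = h x := fun x hx => if_pos hx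
  have g_of_c : ∀ x, dist x c < r → g x = h.symm x := fun x hx => by
    have : ¬ dist x b < r := fun hb => disj x hb hx
    simp only [g, if_neg this, if_pos hx]
  have g_of_far : ∀ x, ¬ dist x b < r → ¬ dist x c < r → g x = x := fun x hb hc => by
    simp only [g, if_neg hb, if_neg hc]
  have g_invol : ∀ x, g (g x) = x := fun x => by
    by_cases hb : dist x b < r
    · rw [g_of_b x hb, g_of_c _ (by rwa [hball]), h.symm_apply_apply]
    · by_cases hc : dist x c < r
      · rw [g_of_c x hc, g_of_b _ (by rwa [hball_symm]), h.apply_symm_apply]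
      · rw [g_of_far x hb hc, g_of_far x hb hc]
  have dist_b_far : ∀ x y, dist x b < r → ¬ dist y b < r → ¬ dist y c < r →
      dist (h x) y = dist x y := fun x y hx hb hc => by
    rw [near x y b hx hb, near (h x) y c (by rwa [hball]) hc, far y hb hc]
  have dist_c_far : ∀ x y, dist x c < r → ¬ dist y b < r → ¬ dist y c < r →
      dist (h.symm x) y = dist x y := fun x y hx hb hc => by
    rw [near x y c hx hc, near (h.symm x) y b (by rwa [hball_symm]) hb, far y hb hc]
  have dist_b_c : ∀ x y, dist x b < r → dist y c < r →
      dist (h x) (h.symm y) = dist x y := fun x y hx hy => by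
    rw [cross x y hx hy, dist_comm, cross _ _ (by rwa [hball_symm]) (by rwa [hball])]
  have g_isom : Isometry g := Isometry.of_dist_eq fun x y => by
    by_cases hxb : dist x b < r
    · rw [g_of_b x hxb]
      by_cases hyb : dist y b < r
      · rw [g_of_b y hyb, h.dist_eq]
      by_cases hyc : dist y c < r
      · rw [g_of_c y hyc, dist_b_c x y hxb hyc]
      · rw [g_of_far y hyb hyc, dist_b_far x y hxb hyb hyc]
    by_cases hxc : dist x c < r
    · rw [g_of_c x hxc]
      by_cases hyb : dist y b < r
      · rw [g_of_b y hyb, dist_comm, dist_b_c y x hyb hxc, dist_comm]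
      by_cases hyc : dist y c < r
      · rw [g_of_c y hyc, h.symm.dist_eq]
      · rw [g_of_far y hyb hyc, dist_c_far x y hxc hyb hyc]
    · rw [g_of_far x hxb hxc]
      by_cases hyb : dist y b < r
      · rw [g_of_b y hyb, dist_comm, dist_b_far y x hyb hxb hxc, dist_comm]
      by_cases hyc : dist y c < r
      · rw [g_of_c y hyc, dist_comm, dist_c_far y x hyc hxb hxc, dist_comm]
      · rw [g_of_far y hyb hyc]
  refine ⟨IsometryEquiv.mk' g g g_invol g_isom, ?_, fun y hb hc => ?_⟩
  · exact (g_of_b b (by rwa [dist_self])).trans hbc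
  · exact g_of_far y (not_lt.2 hb) (not_lt.2 hc)

end Ultrametric

/-- An ultrametric space `M` is homogeneous if and only if its group of
surjective self-isometries acts transitively on `M`. -/
theorem stmt2 {M : Type*} [MetricSpace M]
    (ultra : ∀ x y z : M, dist x z ≤ max (dist x y) (dist y z)) :
    IsHomogeneous M ↔ ∀ x x' : M, ∃ ψ : M ≃ᵢ M, ψ x = x' := by
  refine ⟨fun H x x' => ?_, fun H F hF φ => ?_⟩
  · obtain ⟨ψ, hψ⟩ := H {x} (Set.finite_singleton x) (fun _ => x') (by simp)
    exact ⟨ψ, hψ x rfl⟩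
  induction F, hF using Set.Finite.induction_on with
  | empty => exact fun _ => ⟨IsometryEquiv.refl M, by simp⟩
  | @insert a F _ _ ih =>
    intro hφ
    obtain ⟨ψ, hψ⟩ := ih fun x hx y hy =>
      hφ x (Set.mem_insert_of_mem a hx) y (Set.mem_insert_of_mem a hy)
    obtain ⟨h, hh⟩ := H (ψ a) (φ a)
    obtain ⟨g, hg, hfix⟩ := exists_isometryEquiv_fixing_far_points ultra h hh
    refine ⟨ψ.trans g, fun x hx => ?_⟩
    rcases hx with rfl | hx
    · exact hg
    have hdist : dist (ψ x) (ψ a) = dist (ψ x) (φ a) := by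
      rw [ψ.dist_eq, hψ x hx,
        hφ x (Set.mem_insert_of_mem a hx) a (Set.mem_insert a F)]
    have hle := ultra (ψ a) (ψ x) (φ a)
    rw [dist_comm (ψ a) (ψ x), ← hdist, max_self] at hle
    rw [IsometryEquiv.trans_apply, hfix (ψ x) hle (hdist ▸ hle), hψ x hx]
end

section
/- Let V ⊆ ℝ⁺ with 0 ∈ V, let s assign to each r ∈ V* a cardinal s(r) ≥ 2, and let J be an ideal of subsets of V* (a non-empty collection closed under subsets and finite unions) with J ⊆ Bound(V). Then M_s(J) is a homogeneous ultrametric space and Spec(M_s(J)) = {sup W : W ∈ J} (where sup ∅ = 0). If moreover Fin(V) ⊆ J ⊆ Well(V), then for every r ∈ V* and every B ∈ Nerv(M_s(J)) of diameter r, the number of sons of B equals s(r). -/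
universe u

open Cardinal

/-- A point of the space `M_s(J)`: a function `f` defined on `V* = V \ {0}` such that
`f r` is an element of the cardinal `s r` (viewed as an initial ordinal), whose support
`{r ∈ V* | f r ≠ 0}` belongs to the collection `J`.  (The function is extended by `0`
outside `V*`.) -/
structure MsPoint (V : Set ℝ) (s : ℝ → Cardinal.{u}) (J : Set (Set ℝ)) :
    Type (u + 1) where
  toFun : ℝ → Ordinal.{u}
  lt_ord : ∀ r ∈ V \ {0}, toFun r < (s r).ord
  eq_zero : ∀ r ∉ V \ {0}, toFun r = 0
  supp_mem : {r | r ∈ V \ {0} ∧ toFun r ≠ 0} ∈ J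

/-- The ultrametric distance on `M_s(J)`:
`d(f, g) = sup {r ∈ V* | f r ≠ g r}` (with `sup ∅ = 0`). -/
noncomputable def msDist {V : Set ℝ} {s : ℝ → Cardinal.{u}} {J : Set (Set ℝ)}
    (f g : MsPoint V s J) : ℝ :=
  sSup {r | r ∈ V \ {0} ∧ f.toFun r ≠ g.toFun r}

/-- `Bound(V)`: the subsets of `V* = V \ {0}` which are bounded above in `ℝ`. -/
def BoundSets (V : Set ℝ) : Set (Set ℝ) := {A | A ⊆ V \ {0} ∧ BddAbove A}

/-- `Fin(V)`: the finite subsets of `V* = V \ {0}`. -/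
def FinSets (V : Set ℝ) : Set (Set ℝ) := {A | A ⊆ V \ {0} ∧ A.Finite}

/-- `Well(V)`: the subsets of `V* = V \ {0}` which are well-ordered under `≥`
(equivalently, on which `>` is well-founded). -/
def WellSets (V : Set ℝ) : Set (Set ℝ) :=
  {A | A ⊆ V \ {0} ∧ A.WellFoundedOn (· > · : ℝ → ℝ → Prop)}

section Generic

variable {P : Type*} (d : P → P → ℝ)

/-- `d` is an ultrametric distance on `P`. -/
def IsUltraDist : Prop :=
  (∀ x, d x x = 0) ∧ (∀ x y, d x y = 0 → x = y) ∧ (∀ x y, d x y = d y x) ∧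
    (∀ x y, 0 ≤ d x y) ∧ (∀ x y z, d x z ≤ max (d x y) (d y z))

/-- The space `(P, d)` is homogeneous: every isometry between two finite subsets extends
to a surjective isometry of the whole space onto itself. -/
def IsHomogDist : Prop :=
  ∀ F : Set P, F.Finite → ∀ φ : P → P,
    (∀ x ∈ F, ∀ y ∈ F, d (φ x) (φ y) = d x y) →
    ∃ ψ : P ≃ P, (∀ a b : P, d (ψ a) (ψ b) = d a b) ∧ ∀ x ∈ F, ψ x = φ x

/-- The spectrum of `(P, d)`: the set of values of `d`. -/
def specOf : Set ℝ := {ρ | ∃ x y : P, d x y = ρ}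

/-- The closed ball of center `a` and radius `ρ` in `(P, d)`. -/
def cballOf (a : P) (ρ : ℝ) : Set P := {y | d a y ≤ ρ}

/-- The open ball of center `a` and radius `ρ` in `(P, d)`. -/
def ballOf (a : P) (ρ : ℝ) : Set P := {y | d a y < ρ}

/-- The diameter of a subset of `(P, d)` (with `sup ∅ = 0`). -/
noncomputable def diamOf (B : Set P) : ℝ := sSup {ρ | ∃ x ∈ B, ∃ y ∈ B, d x y = ρ}

/-- The nerve of `(P, d)`: the closed balls `B̂(a, ρ)` with `ρ` a distance attained
from `a`. -/
def nervOf : Set (Set P) :=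
  {B | ∃ (a : P) (ρ : ℝ), (∃ x : P, d a x = ρ) ∧ B = cballOf d a ρ}

/-- The sons of a subset `B` of `(P, d)`: the open balls of radius `δ(B)` contained
in `B`. -/
noncomputable def sonsOf (B : Set P) : Set (Set P) :=
  {S | (∃ a : P, S = ballOf d a (diamOf d B)) ∧ S ⊆ B}

end Generic

section UltraDist

variable {P : Type*} {d : P → P → ℝ}

/-- If some isometry `T` moves `x` to `y`, then so does an isometry fixing each point equidistant
from `x` and `y`: exchange through `T` the open balls of radius `d x y` around `x` and `y`, and fix
every other point. -/
theorem IsUltraDist.exists_swap (hd : IsUltraDist d) (T : P ≃ P)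
    (hT : ∀ a b, d (T a) (T b) = d a b) (x : P) :
    ∃ σ : P ≃ P, (∀ a b, d (σ a) (σ b) = d a b) ∧ σ x = T x ∧
      ∀ b, d x b = d (T x) b → σ b = b := by
  classical
  obtain ⟨hself, heq, hsymm, hnonneg, htri⟩ := hd
  obtain ⟨ρ, hρ⟩ : ∃ ρ, ρ = d x (T x) := ⟨_, rfl⟩
  have hTs (a b) : d (T.symm a) (T.symm b) = d a b := by
    rw [← hT, T.apply_symm_apply, T.apply_symm_apply]
  have hTx (a) : d (T x) (T a) = d x a := hT x a
  have hTsx (a) : d x (T.symm a) = d (T x) a := by rw [← hT, T.apply_symm_apply]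
  have hdisj (a) (h : d x a < ρ) : ¬ d (T x) a < ρ := fun h' => by
    have := htri x a (T x)
    rw [hsymm a (T x), ← hρ] at this
    exact absurd this (not_le.2 (max_lt h h'))
  let σ : P → P := fun a =>
    if d x a < ρ then T a else if d (T x) a < ρ then T.symm a else a
  have hσ₁ (a) (h : d x a < ρ) : σ a = T a := if_pos h
  have hσ₂ (a) (h : d (T x) a < ρ) : σ a = T.symm a := by
    have h' : ¬ d x a < ρ := fun h' => hdisj a h' h
    simp only [σ, if_neg h', if_pos h]
  have hσ₃ (a) (h : ¬ d x a < ρ) (h' : ¬ d (T x) a < ρ) : σ a = a := by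
    simp only [σ, if_neg h', if_neg h]
  have hinv : Function.Involutive σ := fun a => by
    by_cases h : d x a < ρ
    · rw [hσ₁ a h, hσ₂ _ (by rwa [hTx]), T.symm_apply_apply]
    · by_cases h' : d (T x) a < ρ
      · rw [hσ₂ a h', hσ₁ _ (by rwa [hTsx]), T.apply_symm_apply]
      · rw [hσ₃ a h h', hσ₃ a h h']
  have hfar (p q a c) (hpq : d p q = ρ) (ha : d p a < ρ) (hp : ¬ d p c < ρ) (hq : ¬ d q c < ρ)
      (a') (ha' : d q a' < ρ) : d a c = d a' c := by
    have h1 := htri p a c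
    have h2 := htri a p c
    have h3 := htri q a' c
    have h4 := htri a' q c
    have h5 := htri p q c
    have h6 := htri q p c
    rw [hsymm a p] at h2
    rw [hsymm a' q] at h4
    rw [hsymm q p] at h6
    grind
  have hxy : d x (T x) = ρ := hρ.symm
  have hyx : d (T x) x = ρ := by rw [hsymm, hxy]
  refine ⟨hinv.toPerm, fun a b => ?_, ?_, fun b hb => ?_⟩
  · change d (σ a) (σ b) = d a b
    have hcross (a b) (ha : d x a < ρ) (hb : d (T x) b < ρ) : d (T a) (T.symm b) = d a b := by
      have key (u v) (hu : d x u < ρ) (hv : d (T x) v < ρ) : d u v = ρ := by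
        have h1 := htri x u (T x)
        have h2 := htri u v (T x)
        have h3 := htri u x v
        have h4 := htri x (T x) v
        rw [hsymm v (T x)] at h2
        rw [hsymm u x] at h3
        grind
      rw [hsymm, key _ _ (by rwa [hTsx]) (by rwa [hTx]), key _ _ ha hb]
    by_cases ha : d x a < ρ
    · by_cases hb : d x b < ρ
      · rw [hσ₁ a ha, hσ₁ b hb, hT]
      · by_cases hb' : d (T x) b < ρ
        · rw [hσ₁ a ha, hσ₂ b hb', hcross a b ha hb']
        · rw [hσ₁ a ha, hσ₃ b hb hb']
          exact (hfar x (T x) a b hxy ha hb hb' _ (by rwa [hTx])).symm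
    · by_cases ha' : d (T x) a < ρ
      · by_cases hb : d x b < ρ
        · rw [hσ₂ a ha', hσ₁ b hb, hsymm, hcross b a hb ha', hsymm]
        · by_cases hb' : d (T x) b < ρ
          · rw [hσ₂ a ha', hσ₂ b hb', hTs]
          · rw [hσ₂ a ha', hσ₃ b hb hb']
            exact (hfar (T x) x a b hyx ha' hb' hb _ (by rwa [hTsx])).symm
      · rw [hσ₃ a ha ha']
        by_cases hb : d x b < ρ
        · rw [hσ₁ b hb, hsymm, hsymm a]
          exact (hfar x (T x) b a hxy hb ha ha' _ (by rwa [hTx])).symm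
        · by_cases hb' : d (T x) b < ρ
          · rw [hσ₂ b hb', hsymm, hsymm a]
            exact (hfar (T x) x b a hyx hb' ha' ha _ (by rwa [hTsx])).symm
          · rw [hσ₃ b hb hb']
  · change σ x = T x
    rcases (hnonneg x (T x)).eq_or_lt with h | h
    · have hx : T x = x := (heq _ _ h.symm).symm
      have h0 : ρ = 0 := by rw [hρ, ← h]
      rw [hσ₃ x (by rw [hself, h0]; exact lt_irrefl _) (by rw [hyx]; exact lt_irrefl _), hx]
    · exact hσ₁ x (by rwa [hself, hρ])
  · change σ b = b
    refine hσ₃ b (fun h => hdisj b h (hb ▸ h)) (fun h => hdisj b (hb ▸ h) h)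

/-- An ultrametric space whose isometry group is transitive is homogeneous. -/
theorem IsUltraDist.isHomogDist (hd : IsUltraDist d)
    (htrans : ∀ x y, ∃ T : P ≃ P, (∀ a b, d (T a) (T b) = d a b) ∧ T x = y) :
    IsHomogDist d := by
  intro F hF φ
  induction F, hF using Set.Finite.induction_on with
  | empty => exact fun _ => ⟨Equiv.refl P, fun _ _ => rfl, fun _ h => h.elim⟩
  | @insert x F _ _ ih =>
    intro hφ
    obtain ⟨ψ, hψ, hψF⟩ := ih fun a ha b hb =>
      hφ a (Set.mem_insert_of_mem _ ha) b (Set.mem_insert_of_mem _ hb)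
    obtain ⟨T, hT, hTx⟩ := htrans (ψ x) (φ x)
    obtain ⟨σ, hσ, hσx, hσfix⟩ := hd.exists_swap T hT (ψ x)
    refine ⟨ψ.trans σ, fun a b => ?_, fun a ha => ?_⟩
    · rw [Equiv.trans_apply, Equiv.trans_apply, hσ, hψ]
    · rw [Equiv.trans_apply]
      rcases Set.mem_insert_iff.1 ha with rfl | ha'
      · rw [hσx, hTx]
      · have hfix : d (ψ x) (ψ a) = d (T (ψ x)) (ψ a) := by
          rw [hTx, hψ, hψF a ha', hφ x (Set.mem_insert _ _) a ha]
        rw [hσfix _ hfix, hψF a ha']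

/-- The diameter of a member of the nerve is its radius. -/
theorem IsUltraDist.diamOf_cballOf (hd : IsUltraDist d) (a x : P) :
    diamOf d (cballOf d a (d a x)) = d a x := by
  obtain ⟨hself, -, hsymm, hnonneg, htri⟩ := hd
  have hmem : d a x ∈ {ρ | ∃ y ∈ cballOf d a (d a x), ∃ z ∈ cballOf d a (d a x), d y z = ρ} :=
    ⟨a, (hself a).trans_le (hnonneg a x), x, le_refl (d a x), rfl⟩
  refine IsGreatest.csSup_eq ⟨hmem, ?_⟩
  rintro _ ⟨y, hy, z, hz, rfl⟩
  exact (htri y a z).trans (max_le (by rw [hsymm]; exact hy) hz)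

theorem IsUltraDist.ballOf_eq (hd : IsUltraDist d) {a b : P} {r : ℝ} (hab : d a b < r) :
    ballOf d a r = ballOf d b r := by
  obtain ⟨-, -, hsymm, -, htri⟩ := hd
  ext z
  exact ⟨fun h => (htri b a z).trans_lt (max_lt (by rwa [hsymm]) h),
    fun h => (htri a b z).trans_lt (max_lt hab h)⟩

theorem IsUltraDist.mem_ballOf_self (hd : IsUltraDist d) (a : P) {r : ℝ} (hr : 0 < r) :
    a ∈ ballOf d a r :=
  (hd.1 a).trans_lt hr

theorem IsUltraDist.ballOf_subset_cballOf_iff (hd : IsUltraDist d) {a b : P} {r : ℝ}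
    (hr : 0 < r) : ballOf d b r ⊆ cballOf d a r ↔ d a b ≤ r :=
  ⟨fun h => h (hd.mem_ballOf_self b hr), fun h z hz =>
    (hd.2.2.2.2 a b z).trans (max_le h (le_of_lt hz))⟩

end UltraDist

namespace MsPoint

variable {V : Set ℝ} {s : ℝ → Cardinal.{u}} {J : Set (Set ℝ)}

theorem ext_toFun {f g : MsPoint V s J} (h : ∀ r ∈ V \ {0}, f.toFun r = g.toFun r) : f = g := by
  have : f.toFun = g.toFun := by
    funext r
    by_cases hr : r ∈ V \ {0}
    · exact h r hr
    · rw [f.eq_zero r hr, g.eq_zero r hr]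
  cases f
  cases g
  congr

theorem diff_mem (hJdown : ∀ A ∈ J, ∀ B ⊆ A, B ∈ J) (hJunion : ∀ A ∈ J, ∀ B ∈ J, A ∪ B ∈ J)
    (f g : MsPoint V s J) : {r | r ∈ V \ {0} ∧ f.toFun r ≠ g.toFun r} ∈ J := by
  refine hJdown _ (hJunion _ f.supp_mem _ g.supp_mem) _ ?_
  rintro r ⟨hr, hne⟩
  by_cases h : f.toFun r = 0
  · exact Or.inr ⟨hr, fun h' => hne (h.trans h'.symm)⟩
  · exact Or.inl ⟨hr, h⟩

theorem le_msDist {f g : MsPoint V s J}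
    (hb : BddAbove {r | r ∈ V \ {0} ∧ f.toFun r ≠ g.toFun r}) {r : ℝ} (hr : r ∈ V \ {0})
    (h : f.toFun r ≠ g.toFun r) : r ≤ msDist f g :=
  le_csSup hb ⟨hr, h⟩

theorem msDist_le {f g : MsPoint V s J} {ρ : ℝ} (hρ : 0 ≤ ρ)
    (h : ∀ r ∈ V \ {0}, f.toFun r ≠ g.toFun r → r ≤ ρ) : msDist f g ≤ ρ :=
  Real.sSup_le (fun r hr => h r hr.1 hr.2) hρ

theorem isUltraDist (hV : V ⊆ {r : ℝ | 0 ≤ r})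
    (hb : ∀ f g : MsPoint V s J, BddAbove {r | r ∈ V \ {0} ∧ f.toFun r ≠ g.toFun r}) :
    IsUltraDist (@msDist V s J) := by
  have hnonneg (f g : MsPoint V s J) : 0 ≤ msDist f g :=
    Real.sSup_nonneg fun r hr => hV hr.1.1
  refine ⟨fun f => by simp [msDist], fun f g h => ext_toFun fun r hr => ?_, fun f g => ?_,
    hnonneg, fun f g k => ?_⟩
  · by_contra hne
    exact hr.2 (le_antisymm (h ▸ le_msDist (hb f g) hr hne) (hV hr.1))
  · simp only [msDist, ne_comm]
  · refine msDist_le (le_max_of_le_left (hnonneg f g)) fun r hr hne => ?_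
    by_cases h : f.toFun r = g.toFun r
    · exact le_max_of_le_right (le_msDist (hb g k) hr (h ▸ hne))
    · exact le_max_of_le_left (le_msDist (hb f g) hr h)

open Classical in
/-- The coordinatewise transposition of the values of `x` and `y`. -/
noncomputable def swapCoord (hJdown : ∀ A ∈ J, ∀ B ⊆ A, B ∈ J)
    (hJunion : ∀ A ∈ J, ∀ B ∈ J, A ∪ B ∈ J) (x y f : MsPoint V s J) : MsPoint V s J where
  toFun r := Equiv.swap (x.toFun r) (y.toFun r) (f.toFun r)
  lt_ord r hr := by
    rw [Equiv.swap_apply_def]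
    split_ifs
    exacts [y.lt_ord r hr, x.lt_ord r hr, f.lt_ord r hr]
  eq_zero r hr := by rw [x.eq_zero r hr, y.eq_zero r hr, f.eq_zero r hr, Equiv.swap_self]; rfl
  supp_mem := by
    refine hJdown _ (hJunion _ (hJunion _ x.supp_mem _ y.supp_mem) _ f.supp_mem) _ ?_
    rintro r ⟨hr, hne⟩
    by_contra hcon
    simp only [Set.mem_union, Set.mem_ofPred_eq, hr, true_and, not_or, not_not] at hcon
    obtain ⟨⟨hx, hy⟩, hf⟩ := hcon
    rw [hx, hy, hf, Equiv.swap_self] at hne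
    exact hne rfl

theorem exists_isometry (hJdown : ∀ A ∈ J, ∀ B ⊆ A, B ∈ J)
    (hJunion : ∀ A ∈ J, ∀ B ∈ J, A ∪ B ∈ J) (x y : MsPoint V s J) :
    ∃ T : MsPoint V s J ≃ MsPoint V s J,
      (∀ a b, msDist (T a) (T b) = msDist a b) ∧ T x = y := by
  classical
  have hinv : Function.Involutive (swapCoord hJdown hJunion x y) := fun f =>
    ext_toFun fun r _ => by simp [swapCoord]
  refine ⟨hinv.toPerm, fun a b => ?_, ext_toFun fun r _ => ?_⟩
  · change msDist (swapCoord hJdown hJunion x y a) (swapCoord hJdown hJunion x y b) = _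
    simp only [msDist, swapCoord, ne_eq, EmbeddingLike.apply_eq_iff_eq]
  · exact Equiv.swap_apply_left _ _

open Classical in
/-- The indicator function of a member of `J`. -/
noncomputable def indicator (hJV : ∀ A ∈ J, A ⊆ V \ {0}) (hs : ∀ r ∈ V \ {0}, 2 ≤ s r)
    (hJdown : ∀ A ∈ J, ∀ B ⊆ A, B ∈ J) (W : Set ℝ) (hW : W ∈ J) : MsPoint V s J where
  toFun r := if r ∈ W then 1 else 0
  lt_ord r hr := by
    have h : (1 : Ordinal.{u}) < (s r).ord := by
      rw [Cardinal.lt_ord, Ordinal.card_one]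
      exact Cardinal.one_lt_two.trans_le (hs r hr)
    split_ifs
    exacts [h, zero_lt_one.trans h]
  eq_zero r hr := if_neg fun h => hr (hJV W hW h)
  supp_mem := hJdown W hW _ fun r hr => by
    by_contra h
    exact hr.2 (if_neg h)

theorem specOf_msDist (hJV : ∀ A ∈ J, A ⊆ V \ {0}) (hs : ∀ r ∈ V \ {0}, 2 ≤ s r)
    (hJne : J.Nonempty) (hJdown : ∀ A ∈ J, ∀ B ⊆ A, B ∈ J)
    (hJunion : ∀ A ∈ J, ∀ B ∈ J, A ∪ B ∈ J) :
    specOf (@msDist V s J) = {ρ | ∃ W ∈ J, sSup W = ρ} := by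
  ext ρ
  constructor
  · rintro ⟨f, g, rfl⟩
    exact ⟨_, diff_mem hJdown hJunion f g, rfl⟩
  · rintro ⟨W, hW, rfl⟩
    obtain ⟨A, hA⟩ := hJne
    refine ⟨indicator hJV hs hJdown W hW,
      indicator hJV hs hJdown ∅ (hJdown A hA ∅ (Set.empty_subset A)), ?_⟩
    rw [msDist]
    congr 1
    ext r
    simp only [indicator, Set.mem_ofPred_eq, Set.mem_empty_iff_false, if_false, ne_eq,
      ite_eq_right_iff, one_ne_zero, imp_false, not_not]
    exact ⟨And.right, fun h => ⟨hJV W hW h, h⟩⟩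

open Classical in
/-- The point `a` with its value at `r` replaced by `α`. -/
noncomputable def updateAt (hJdown : ∀ A ∈ J, ∀ B ⊆ A, B ∈ J)
    (hJunion : ∀ A ∈ J, ∀ B ∈ J, A ∪ B ∈ J) {r : ℝ} (hr : r ∈ V \ {0}) (hrJ : {r} ∈ J)
    (a : MsPoint V s J) (α : Set.Iio (s r).ord) : MsPoint V s J where
  toFun := Function.update a.toFun r α
  lt_ord t ht := by
    rcases eq_or_ne t r with rfl | h
    · rw [Function.update_self]; exact α.2
    · rw [Function.update_of_ne h]; exact a.lt_ord t ht
  eq_zero t ht := by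
    have h : t ≠ r := fun h => ht (h ▸ hr)
    rw [Function.update_of_ne h, a.eq_zero t ht]
  supp_mem := by
    refine hJdown _ (hJunion _ a.supp_mem _ hrJ) _ ?_
    rintro t ⟨ht, hne⟩
    rcases eq_or_ne t r with h | h
    · exact Or.inr h
    · rw [Function.update_of_ne h] at hne
      exact Or.inl ⟨ht, hne⟩

/-- When the members of `J` are well-ordered under `≥`, a distance at most `r` is smaller than `r`
exactly when the coordinates at `r` agree. -/
theorem msDist_lt_iff (hb : ∀ f g : MsPoint V s J,
      BddAbove {r | r ∈ V \ {0} ∧ f.toFun r ≠ g.toFun r})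
    (hJdown : ∀ A ∈ J, ∀ B ⊆ A, B ∈ J) (hJunion : ∀ A ∈ J, ∀ B ∈ J, A ∪ B ∈ J)
    (hwell : J ⊆ WellSets V) {r : ℝ} (hr : r ∈ V \ {0}) (hr0 : 0 < r) {f g : MsPoint V s J}
    (hle : msDist f g ≤ r) : msDist f g < r ↔ f.toFun r = g.toFun r := by
  constructor
  · intro h
    by_contra hne
    exact absurd (le_msDist (hb f g) hr hne) (not_le.2 h)
  · intro h
    refine lt_of_le_of_ne hle fun heq => ?_
    obtain ⟨D, hD⟩ : ∃ D, D = {r | r ∈ V \ {0} ∧ f.toFun r ≠ g.toFun r} := ⟨_, rfl⟩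
    have hsup : sSup D = r := by rw [hD]; exact heq
    have hne : D.Nonempty := by
      by_contra hemp
      rw [Set.not_nonempty_iff_eq_empty.1 hemp, Real.sSup_empty] at hsup
      exact hr0.ne hsup
    have hDJ : D ∈ J := hD ▸ diff_mem hJdown hJunion f g
    obtain ⟨⟨m, hm⟩, -, hmax⟩ :=
      WellFounded.has_min (hwell hDJ).2 Set.univ ⟨⟨_, hne.some_mem⟩, trivial⟩
    have hmsup : sSup D = m :=
      IsGreatest.csSup_eq ⟨hm, fun t ht => not_lt.1 (hmax ⟨t, ht⟩ trivial)⟩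
    have hrD : r ∈ D := by rw [← hsup, hmsup]; exact hm
    rw [hD] at hrD
    exact hrD.2 h

theorem mk_sonsOf (hd : IsUltraDist (@msDist V s J))
    (hb : ∀ f g : MsPoint V s J, BddAbove {r | r ∈ V \ {0} ∧ f.toFun r ≠ g.toFun r})
    (hJdown : ∀ A ∈ J, ∀ B ⊆ A, B ∈ J) (hJunion : ∀ A ∈ J, ∀ B ∈ J, A ∪ B ∈ J)
    (hfin : FinSets V ⊆ J) (hwell : J ⊆ WellSets V) {r : ℝ} (hr : r ∈ V \ {0}) (hr0 : 0 < r)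
    {B : Set (MsPoint V s J)} (hB : B ∈ nervOf (@msDist V s J))
    (hdiam : diamOf (@msDist V s J) B = r) :
    Cardinal.mk (sonsOf (@msDist V s J) B) = Cardinal.lift.{u + 1} (s r) := by
  obtain ⟨a, ρ, ⟨x, rfl⟩, rfl⟩ := hB
  have hρ := hdiam
  rw [hd.diamOf_cballOf] at hρ
  rw [hρ] at hdiam ⊢
  have hrJ : {r} ∈ J := hfin ⟨Set.singleton_subset_iff.2 hr, Set.finite_singleton r⟩
  let p : Set.Iio (s r).ord → MsPoint V s J := updateAt hJdown hJunion hr hrJ a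
  have hpr (α) : (p α).toFun r = α := Function.update_self _ _ _
  have hap (α) : msDist a (p α) ≤ r := msDist_le hr0.le fun t _ hne => by
    by_contra hlt
    exact hne (Function.update_of_ne (fun h => hlt h.le) _ _).symm
  have hclose (b c) (hab : msDist a b ≤ r) (hac : msDist a c ≤ r) : msDist b c ≤ r :=
    (hd.2.2.2.2 b a c).trans (max_le (by rwa [hd.2.2.1]) hac)
  let e (α : Set.Iio (s r).ord) : sonsOf (@msDist V s J) (cballOf msDist a r) :=
    ⟨ballOf msDist (p α) r, ⟨p α, by rw [hdiam]⟩, (hd.ballOf_subset_cballOf_iff hr0).2 (hap α)⟩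
  have he : Function.Bijective e := by
    constructor
    · intro α β h
      have hball : ballOf msDist (p α) r = ballOf msDist (p β) r := congrArg Subtype.val h
      have hlt : msDist (p α) (p β) < r := by
        have := hd.mem_ballOf_self (p β) hr0
        rwa [← hball] at this
      have := (msDist_lt_iff hb hJdown hJunion hwell hr hr0 hlt.le).1 hlt
      rw [hpr, hpr] at this
      exact Subtype.ext this
    · rintro ⟨_, ⟨b, rfl⟩, hsub⟩
      rw [hdiam, hd.ballOf_subset_cballOf_iff hr0] at hsub
      refine ⟨⟨b.toFun r, b.lt_ord r hr⟩, Subtype.ext ?_⟩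
      change ballOf msDist (p _) r = ballOf msDist b (diamOf msDist (cballOf msDist a r))
      rw [hdiam]
      refine hd.ballOf_eq ((msDist_lt_iff hb hJdown hJunion hwell hr hr0 ?_).2 (hpr _))
      exact hclose _ _ (hap _) hsub
  rw [← Cardinal.mk_congr (Equiv.ofBijective e he), Cardinal.mk_Iio_ordinal, Cardinal.card_ord]

end MsPoint

/-- Let `V ⊆ ℝ⁺` with `0 ∈ V`, let `s` assign to each `r ∈ V*` a
cardinal `s r ≥ 2`, and let `J` be an ideal of subsets of `V*` with `J ⊆ Bound(V)`.
Then `M_s(J)` is a homogeneous ultrametric space and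
`Spec(M_s(J)) = {sup W : W ∈ J}` (with `sup ∅ = 0`).  If moreover
`Fin(V) ⊆ J ⊆ Well(V)`, then for every `r ∈ V*`, every member of the nerve of `M_s(J)`
of diameter `r` has exactly `s r` sons. -/
theorem stmt4 (V : Set ℝ) (hV : V ⊆ {r : ℝ | 0 ≤ r}) (h0V : (0 : ℝ) ∈ V)
    (s : ℝ → Cardinal.{u}) (hs : ∀ r ∈ V \ {0}, 2 ≤ s r)
    (J : Set (Set ℝ)) (hJB : J ⊆ BoundSets V) (hJne : J.Nonempty)
    (hJdown : ∀ A ∈ J, ∀ B ⊆ A, B ∈ J)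
    (hJunion : ∀ A ∈ J, ∀ B ∈ J, A ∪ B ∈ J) :
    IsUltraDist (@msDist V s J) ∧
      IsHomogDist (@msDist V s J) ∧
      specOf (@msDist V s J) = {ρ | ∃ W ∈ J, sSup W = ρ} ∧
      ((FinSets V ⊆ J ∧ J ⊆ WellSets V) →
        ∀ r ∈ V \ {0}, ∀ B ∈ nervOf (@msDist V s J),
          diamOf (@msDist V s J) B = r →
            Cardinal.mk (sonsOf (@msDist V s J) B) = Cardinal.lift.{u + 1} (s r)) := by
  have hJV : ∀ A ∈ J, A ⊆ V \ {0} := fun A hA => (hJB hA).1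
  have hb (f g : MsPoint V s J) : BddAbove {r | r ∈ V \ {0} ∧ f.toFun r ≠ g.toFun r} :=
    (hJB (MsPoint.diff_mem hJdown hJunion f g)).2
  have hd := MsPoint.isUltraDist hV hb
  refine ⟨hd, hd.isHomogDist (MsPoint.exists_isometry hJdown hJunion),
    MsPoint.specOf_msDist hJV hs hJne hJdown hJunion, fun ⟨hfin, hwell⟩ r hr B hB hdiam => ?_⟩
  exact MsPoint.mk_sonsOf hd hb hJdown hJunion hfin hwell hr
    (lt_of_le_of_ne (hV hr.1) fun h => hr.2 h.symm) hB hdiam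
end

section
/- Let V be a subset of ℝ⁺ containing ℚ⁺ and let s be a function assigning to each r ∈ V* a cardinal s(r) ≥ 2. Then there is an ω₁-indexed family (M_γ)_{γ<ω₁} of homogeneous ultrametric spaces, each with spectrum V and degree sequence s, which is strictly increasing under isometric embeddability: for γ < γ', M_γ embeds isometrically into M_{γ'} but M_{γ'} does not embed isometrically into M_γ. -/
section UltrametricHomogeneity

variable {P : Type*} {d : P → P → ℝ}

/-- If an isometry `θ` of an ultrametric space maps `a` to `b`, then the map exchanging the open
balls of radius `d a b` around `a` and `b` along `θ` and fixing every other point is an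
isometry. -/
theorem IsUltraDist.exists_isometry_exchanging_balls (hd : IsUltraDist d) {a b : P} (θ : P ≃ P)
    (hθ : ∀ x y, d (θ x) (θ y) = d x y) (hab : θ a = b) :
    ∃ χ : P ≃ P, (∀ x y, d (χ x) (χ y) = d x y) ∧ χ a = b ∧
      ∀ x, d a b ≤ d x a → d a b ≤ d x b → χ x = x := by
  classical
  obtain ⟨h0, h1, hs, hp, ht⟩ := hd
  by_cases hne : a = b
  · exact ⟨Equiv.refl P, fun _ _ => rfl, hne, fun _ _ _ => rfl⟩
  have hr : 0 < d a b := lt_of_le_of_ne (hp a b) fun h => hne (h1 a b h.symm)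
  have hθ' : ∀ x y, d (θ.symm x) (θ.symm y) = d x y := fun x y => by
    rw [← hθ, θ.apply_symm_apply, θ.apply_symm_apply]
  have hA : ∀ x, d (θ x) b = d x a := fun x => by rw [← hab, hθ]
  have hB : ∀ x, d (θ.symm x) a = d x b := fun x => by rw [← hA, θ.apply_symm_apply]
  have hdisj : ∀ x, d x a < d a b → ¬ d x b < d a b := fun x hx hx' => by
    have := ht a x b
    rw [hs a x] at this
    exact absurd this (not_le.mpr (max_lt hx hx'))
  set χ : P → P := fun x =>
    if d x a < d a b then θ x else if d x b < d a b then θ.symm x else x with hχ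
  have hχχ : ∀ x y, d (χ x) (χ y) = d x y := by
    have cross : ∀ u v c e, d u c < d c e → d v e < d c e → d u v = d c e := by
      intro u v c e hu hv
      have t1 := ht c u e
      have t2 := ht u v e
      have t3 := ht u c v
      have t4 := ht c e v
      have := hs c u
      have := hs e v
      grind
    have far : ∀ u v y, d u a < d a b → d v b < d a b → d a b ≤ d y a → d a b ≤ d y b →
        d u y = d v y := by
      intro u v y hu hv h2 h3
      have := cross u v a b hu hv
      have t1 := ht y u a
      have t2 := ht y v b
      have t3 := ht u v y
      have t4 := ht v u y
      have := hs y u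
      have := hs y v
      have := hs u v
      grind
    have key_aa : ∀ x y, d x a < d a b → d y a < d a b → d (χ x) (χ y) = d x y := by
      intro x y hx hy
      simp only [hχ, if_pos hx, if_pos hy, hθ]
    have key_bb : ∀ x y, d x b < d a b → d y b < d a b → d (χ x) (χ y) = d x y := by
      intro x y hx hy
      have hx' := fun h => hdisj x h hx
      have hy' := fun h => hdisj y h hy
      simp only [hχ, if_neg hx', if_neg hy', if_pos hx, if_pos hy, hθ']
    have key_ab : ∀ x y, d x a < d a b → d y b < d a b → d (χ x) (χ y) = d x y := by
      intro x y hx hy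
      have hy' := fun h => hdisj y h hy
      simp only [hχ, if_pos hx, if_neg hy', if_pos hy]
      rw [cross x y a b hx hy, hs]
      exact cross _ _ a b ((hB y).trans_lt hy) ((hA x).trans_lt hx)
    have key_a : ∀ x y, d x a < d a b → d a b ≤ d y a ∧ d a b ≤ d y b →
        d (χ x) (χ y) = d x y := by
      intro x y hx ⟨h2, h3⟩
      simp only [hχ, if_pos hx, if_neg h2.not_gt, if_neg h3.not_gt]
      exact (far x (θ x) y hx ((hA x).trans_lt hx) h2 h3).symm
    have key_b : ∀ x y, d x b < d a b → d a b ≤ d y a ∧ d a b ≤ d y b →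
        d (χ x) (χ y) = d x y := by
      intro x y hx ⟨h2, h3⟩
      have hx' := fun h => hdisj x h hx
      simp only [hχ, if_neg hx', if_pos hx, if_neg h2.not_gt, if_neg h3.not_gt]
      exact far (θ.symm x) x y ((hB x).trans_lt hx) hx h2 h3
    have tri : ∀ x, d x a < d a b ∨ d x b < d a b ∨ (d a b ≤ d x a ∧ d a b ≤ d x b) := by
      intro x
      rcases lt_or_ge (d x a) (d a b) with h | h
      · exact Or.inl h
      · exact Or.inr ((lt_or_ge (d x b) (d a b)).imp_right fun h' => ⟨h, h'⟩)
    intro x y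
    have symm : d (χ y) (χ x) = d y x → d (χ x) (χ y) = d x y := fun h => by
      rw [hs, h, hs]
    rcases tri x with hx | hx | hx <;> rcases tri y with hy | hy | hy
    · exact key_aa x y hx hy
    · exact key_ab x y hx hy
    · exact key_a x y hx hy
    · exact symm (key_ab y x hy hx)
    · exact key_bb x y hx hy
    · exact key_b x y hx hy
    · exact symm (key_a y x hy hx)
    · exact symm (key_b y x hy hx)
    · simp only [hχ, if_neg hx.1.not_gt, if_neg hx.2.not_gt, if_neg hy.1.not_gt,
        if_neg hy.2.not_gt]
  have hinv : Function.Involutive χ := by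
    intro x
    by_cases hx : d x a < d a b
    · have h2 : d (θ x) b < d a b := (hA x).trans_lt hx
      have h3 := fun h => hdisj (θ x) h h2
      simp only [hχ, if_pos hx, if_neg h3, if_pos h2, θ.symm_apply_apply]
    · by_cases hx' : d x b < d a b
      · have h2 : d (θ.symm x) a < d a b := (hB x).trans_lt hx'
        simp only [hχ, if_neg hx, if_pos hx', if_pos h2, θ.apply_symm_apply]
      · simp only [hχ, if_neg hx, if_neg hx']
  refine ⟨hinv.toPerm, hχχ, ?_, fun x hx hx' => ?_⟩
  · change χ a = b
    simp only [hχ, if_pos ((h0 a).trans_lt hr), hab]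
  · change χ x = x
    simp only [hχ, if_neg hx.not_gt, if_neg hx'.not_gt]

/-- An ultrametric space whose isometry group is transitive is homogeneous. -/
theorem IsUltraDist.isHomogDist_of_transitive (hd : IsUltraDist d)
    (htr : ∀ a b : P, ∃ θ : P ≃ P, (∀ x y, d (θ x) (θ y) = d x y) ∧ θ a = b) :
    IsHomogDist d := by
  intro F hF φ
  induction F, hF using Set.Finite.induction_on with
  | empty => exact fun _ => ⟨Equiv.refl P, fun _ _ => rfl, fun x hx => hx.elim⟩
  | @insert a F _ _ ih =>
    intro hφ
    obtain ⟨ψ, hψ, hψF⟩ := ih fun x hx y hy =>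
      hφ x (Set.mem_insert_of_mem _ hx) y (Set.mem_insert_of_mem _ hy)
    obtain ⟨θ, hθ, hθa⟩ := htr (ψ a) (φ a)
    obtain ⟨χ, hχ, hχa, hχF⟩ := hd.exists_isometry_exchanging_balls θ hθ hθa
    refine ⟨ψ.trans χ, fun x y => by simp [hχ, hψ], ?_⟩
    rintro x (rfl | hx)
    · exact hχa
    · obtain ⟨-, -, hs, -, ht⟩ := hd
      have e1 : d (ψ x) (ψ a) = d x a := hψ x a
      have e2 : d (ψ x) (φ a) = d x a := by
        rw [hψF x hx]
        exact hφ x (Set.mem_insert_of_mem _ hx) a (Set.mem_insert _ _)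
      have t := ht (ψ a) (ψ x) (φ a)
      rw [hs (ψ a) (ψ x), e1, e2, max_self] at t
      rw [Equiv.trans_apply, hχF (ψ x) (t.trans_eq e1.symm) (t.trans_eq e2.symm), hψF x hx]

end UltrametricHomogeneity

section RankBelow

variable {X : Type*} [LinearOrder X] {β : Ordinal.{0}}

/-- `A` is dually well-ordered, of order type less than `β`. -/
def HasRankBelow (β : Ordinal.{0}) (A : Set X) : Prop :=
  ∃ θ < β, ∃ ρ : X → Ordinal.{0}, (∀ x ∈ A, ρ x < θ) ∧ StrictAntiOn ρ A

theorem HasRankBelow.mono {A B : Set X} (hA : HasRankBelow β A) (h : B ⊆ A) :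
    HasRankBelow β B := by
  obtain ⟨θ, hθ, ρ, hρ, hρA⟩ := hA
  exact ⟨θ, hθ, ρ, fun x hx => hρ x (h hx), hρA.mono h⟩

theorem HasRankBelow.mono_ordinal {β' : Ordinal.{0}} {A : Set X} (hA : HasRankBelow β A)
    (h : β ≤ β') : HasRankBelow β' A := by
  obtain ⟨θ, hθ, H⟩ := hA
  exact ⟨θ, hθ.trans_le h, H⟩

theorem hasRankBelow_empty (hβ : 0 < β) : HasRankBelow β (∅ : Set X) :=
  ⟨0, hβ, fun _ => 0, fun _ h => h.elim, fun _ h => h.elim⟩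

theorem HasRankBelow.wellFoundedOn {A : Set X} (hA : HasRankBelow β A) :
    A.WellFoundedOn (· > ·) := by
  obtain ⟨θ, hθ, ρ, hρ, hρA⟩ := hA
  refine Subrelation.wf (r := InvImage (· < ·) fun x : A => ρ x) ?_ (InvImage.wf _ wellFounded_lt)
  intro x y h
  exact hρA y.2 x.2 h

theorem HasRankBelow.of_above_below {A : Set X} (hβ : Ordinal.IsPrincipal (· + ·) β)
    (hβ1 : 1 < β) (r : X) (h₁ : HasRankBelow β {x ∈ A | r < x})
    (h₂ : HasRankBelow β {x ∈ A | x < r}) : HasRankBelow β A := by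
  obtain ⟨θ₁, hθ₁, ρ₁, hρ₁, hs₁⟩ := h₁
  obtain ⟨θ₂, hθ₂, ρ₂, hρ₂, hs₂⟩ := h₂
  have hle : θ₁ < θ₁ + 1 := by simp
  refine ⟨θ₁ + 1 + θ₂, hβ (hβ hθ₁ hβ1) hθ₂, fun x =>
    if r < x then ρ₁ x else if x < r then θ₁ + 1 + ρ₂ x else θ₁, fun x hx => ?_,
    fun x hx y hy hxy => ?_⟩
  · dsimp only
    split_ifs with h h'
    · exact ((hρ₁ x ⟨hx, h⟩).trans hle).trans_le le_self_add
    · exact (add_lt_add_iff_left _).mpr (hρ₂ x ⟨hx, h'⟩)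
    · exact hle.trans_le le_self_add
  · dsimp only
    rcases lt_trichotomy r x with h | h | h
    · rw [if_pos h, if_pos (h.trans hxy)]
      exact hs₁ ⟨hx, h⟩ ⟨hy, h.trans hxy⟩ hxy
    · subst h
      rw [if_neg (lt_irrefl _), if_neg (lt_irrefl _), if_pos hxy]
      exact hρ₁ y ⟨hy, hxy⟩
    · rw [if_neg h.not_gt, if_pos h]
      split_ifs with h1 h2
      · exact ((hρ₁ y ⟨hy, h1⟩).trans hle).trans_le le_self_add
      · exact (add_lt_add_iff_left _).mpr (hs₂ ⟨hx, h⟩ ⟨hy, h2⟩ hxy)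
      · exact hle.trans_le le_self_add

theorem hasRankBelow_range {α : Ordinal.{0}} (hα : α < β) {e : Set.Iio α → X}
    (he : StrictAnti e) : HasRankBelow β (Set.range e) := by
  classical
  refine ⟨α, hα, fun x => if h : x ∈ Set.range e then (h.choose : Ordinal) else 0, ?_, ?_⟩
  · intro x hx
    dsimp only
    rw [dif_pos hx]
    exact hx.choose.2
  · intro x hx y hy hxy
    dsimp only
    rw [dif_pos hx, dif_pos hy, Subtype.coe_lt_coe, ← he.lt_iff_gt]
    rwa [hx.choose_spec, hy.choose_spec]

theorem not_hasRankBelow_range {α : Ordinal.{0}} {e : Set.Iio α → X} (he : StrictAnti e) :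
    ¬ HasRankBelow α (Set.range e) := by
  rintro ⟨θ, hθ, ρ, hρ, hs⟩
  have key : ∀ ξ (h : ξ < α), ξ ≤ ρ (e ⟨ξ, h⟩) := by
    intro ξ
    induction ξ using WellFoundedLT.induction with
    | ind ξ ih =>
      intro h
      refine le_of_forall_lt fun η hη => (ih η hη (hη.trans h)).trans_lt ?_
      exact hs ⟨_, rfl⟩ ⟨_, rfl⟩ (he (Subtype.mk_lt_mk.mpr hη))
  exact (key θ hθ).not_gt (hρ _ ⟨_, rfl⟩)

end RankBelow

section HahnSpace

universe u

variable {W : Set ℝ} {S : W → Type u}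

/-- The functions `f ∈ ∏ r, S r` whose support (with respect to the base point `z`) is dually
well-ordered of order type less than `β`. -/
def HahnSpace (z : ∀ r, S r) (β : Ordinal.{0}) : Type u :=
  {f : ∀ r, S r // HasRankBelow β {r | f r ≠ z r}}

/-- The distance of two functions: the largest point where they differ. -/
noncomputable def hahnDist {z : ∀ r, S r} {β : Ordinal.{0}} (f g : HahnSpace z β) : ℝ :=
  sSup ((↑) '' {r : W | f.1 r ≠ g.1 r})

namespace HahnSpace

variable {z : ∀ r, S r} {β : Ordinal.{0}}

theorem exists_largest_ne {f g : HahnSpace z β} (h : f ≠ g) :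
    ∃ r, f.1 r ≠ g.1 r ∧ ∀ y, r < y → f.1 y = g.1 y := by
  have hwf : ({r | f.1 r ≠ z r} ∪ {r | g.1 r ≠ z r}).WellFoundedOn (· > ·) :=
    f.2.wellFoundedOn.union g.2.wellFoundedOn
  have hsub : {r | f.1 r ≠ g.1 r} ⊆ {r | f.1 r ≠ z r} ∪ {r | g.1 r ≠ z r} := by
    intro r hr
    by_contra hc
    simp only [Set.mem_union, Set.mem_ofPred_eq, not_or, not_not] at hc
    exact hr (hc.1.trans hc.2.symm)
  obtain ⟨r, hr⟩ : ∃ r, f.1 r ≠ g.1 r := by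
    by_contra! hc
    exact h (Subtype.ext (funext hc))
  obtain ⟨m, -, hm⟩ := (hwf.subset hsub).has_min Set.univ ⟨⟨r, hr⟩, trivial⟩
  refine ⟨m, m.2, fun y hy => ?_⟩
  by_contra hc
  exact hm ⟨y, hc⟩ trivial hy

theorem dist_eq_of_largest_ne {f g : HahnSpace z β} {r : W} (hr : f.1 r ≠ g.1 r)
    (h : ∀ y, r < y → f.1 y = g.1 y) : hahnDist f g = r := by
  refine IsGreatest.csSup_eq ⟨⟨r, hr, rfl⟩, ?_⟩
  rintro _ ⟨y, hy, rfl⟩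
  exact Subtype.coe_le_coe.mpr (not_lt.mp fun hlt => hy (h y hlt))

theorem dist_self (f : HahnSpace z β) : hahnDist f f = 0 := by
  simp [hahnDist]

theorem dist_comm (f g : HahnSpace z β) : hahnDist f g = hahnDist g f := by
  simp only [hahnDist, ne_comm]

theorem dist_le_iff {f g : HahnSpace z β} {t : ℝ} (ht : 0 ≤ t) :
    hahnDist f g ≤ t ↔ ∀ y : W, t < y → f.1 y = g.1 y := by
  rcases eq_or_ne f g with rfl | h
  · simp [dist_self, ht]
  · obtain ⟨r, hr, hr'⟩ := exists_largest_ne h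
    rw [dist_eq_of_largest_ne hr hr']
    refine ⟨fun h y hy => hr' y (Subtype.coe_lt_coe.mp (h.trans_lt hy)), fun h => ?_⟩
    by_contra! hc
    exact hr (h r hc)

theorem dist_lt_iff {f g : HahnSpace z β} {t : ℝ} (ht : 0 < t) :
    hahnDist f g < t ↔ ∀ y : W, t ≤ y → f.1 y = g.1 y := by
  rcases eq_or_ne f g with rfl | h
  · simp [dist_self, ht]
  · obtain ⟨r, hr, hr'⟩ := exists_largest_ne h
    rw [dist_eq_of_largest_ne hr hr']
    refine ⟨fun h y hy => hr' y (Subtype.coe_lt_coe.mp (h.trans_le hy)), fun h => ?_⟩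
    by_contra! hc
    exact hr (h r hc)

theorem isUltraDist (hW : ∀ r ∈ W, 0 < r) : IsUltraDist (hahnDist (z := z) (β := β)) := by
  have hp : ∀ f g : HahnSpace z β, 0 ≤ hahnDist f g := by
    intro f g
    refine Real.sSup_nonneg ?_
    rintro _ ⟨r, -, rfl⟩
    exact (hW r r.2).le
  refine ⟨dist_self, fun f g h => ?_, dist_comm, hp, fun f g k => ?_⟩
  · by_contra hne
    obtain ⟨r, hr, hr'⟩ := exists_largest_ne hne
    rw [dist_eq_of_largest_ne hr hr'] at h
    exact (hW r r.2).ne' h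
  · refine (dist_le_iff ((hp f g).trans (le_max_left _ _))).mpr fun y hy => ?_
    have h1 := (dist_le_iff (hp f g)).mp le_rfl y ((le_max_left _ _).trans_lt hy)
    exact h1.trans ((dist_le_iff (hp g k)).mp le_rfl y ((le_max_right _ _).trans_lt hy))

open Classical in
/-- The map which, along the branch of `f`, exchanges `f` and `g`. -/
noncomputable def branchSwap (f g h : ∀ r, S r) (r : W) : S r :=
  if ∀ y, r < y → h y = f y then Equiv.swap (f r) (g r) (h r) else h r

theorem branchSwap_self (f g : ∀ r, S r) : branchSwap f g f = g := by
  funext r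
  simp [branchSwap]

open Classical in
theorem hasRankBelow_branchSwap (hβ : Ordinal.IsPrincipal (· + ·) β) (hβ1 : 1 < β)
    (f g h : HahnSpace z β) : HasRankBelow β {r | branchSwap f.1 g.1 h.1 r ≠ z r} := by
  rcases eq_or_ne h f with rfl | hne
  · rw [branchSwap_self]
    exact g.2
  obtain ⟨r, hr, hr'⟩ := exists_largest_ne hne
  refine HasRankBelow.of_above_below hβ hβ1 r (g.2.mono ?_) (h.2.mono ?_)
  · rintro x ⟨hx, hrx⟩
    have : branchSwap f.1 g.1 h.1 x = g.1 x := by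
      rw [branchSwap, if_pos fun y hy => hr' y (hrx.trans hy), hr' x hrx, Equiv.swap_apply_left]
    rwa [Set.mem_ofPred_eq, this] at hx
  · rintro x ⟨hx, hxr⟩
    have : branchSwap f.1 g.1 h.1 x = h.1 x := by
      rw [branchSwap, if_neg fun hc => hr (hc r hxr)]
    rwa [Set.mem_ofPred_eq, this] at hx

open Classical in
theorem branchSwap_branchSwap (f g h : HahnSpace z β) :
    branchSwap g.1 f.1 (branchSwap f.1 g.1 h.1) = h.1 := by
  funext r
  have hiff : (∀ y, r < y → branchSwap f.1 g.1 h.1 y = g.1 y) ↔ ∀ y, r < y → h.1 y = f.1 y := by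
    refine ⟨fun H => ?_, fun H y hy => ?_⟩
    · rcases eq_or_ne h f with rfl | hne
      · exact fun _ _ => rfl
      obtain ⟨m, hm, hm'⟩ := exists_largest_ne hne
      intro y hy
      refine hm' y (lt_of_le_of_lt (not_lt.mp fun hrm => hm ?_) hy)
      have := H m hrm
      rw [branchSwap, if_pos hm', Equiv.swap_apply_eq_iff, Equiv.swap_apply_right] at this
      exact this
    · rw [branchSwap, if_pos fun w hw => H w (hy.trans hw), H y hy, Equiv.swap_apply_left]
  rw [branchSwap]
  by_cases H : ∀ y, r < y → h.1 y = f.1 y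
  · rw [if_pos (hiff.mpr H), branchSwap, if_pos H, Equiv.swap_comm, Equiv.swap_apply_eq_iff]
  · rw [if_neg (mt hiff.mp H), branchSwap, if_neg H]

open Classical in
theorem exists_isometry_apply_eq (hβ : Ordinal.IsPrincipal (· + ·) β) (hβ1 : 1 < β)
    (f g : HahnSpace z β) :
    ∃ θ : HahnSpace z β ≃ HahnSpace z β,
      (∀ x y, hahnDist (θ x) (θ y) = hahnDist x y) ∧ θ f = g := by
  refine ⟨⟨fun h => ⟨_, hasRankBelow_branchSwap hβ hβ1 f g h⟩,
    fun h => ⟨_, hasRankBelow_branchSwap hβ hβ1 g f h⟩,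
    fun h => Subtype.ext (branchSwap_branchSwap f g h),
    fun h => Subtype.ext (branchSwap_branchSwap g f h)⟩, fun h k => ?_,
    Subtype.ext (branchSwap_self f.1 g.1)⟩
  rcases eq_or_ne h k with rfl | hne
  · rw [dist_self, dist_self]
  obtain ⟨r, hr, hr'⟩ := exists_largest_ne hne
  rw [dist_eq_of_largest_ne hr hr']
  have hcond : ∀ x, r ≤ x →
      ((∀ y, x < y → h.1 y = f.1 y) ↔ ∀ y, x < y → k.1 y = f.1 y) := fun x hx =>
    forall₂_congr fun y hy => by rw [hr' y (hx.trans_lt hy)]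
  refine dist_eq_of_largest_ne ?_ fun y hy => ?_
  · change branchSwap f.1 g.1 h.1 r ≠ branchSwap f.1 g.1 k.1 r
    rw [branchSwap, branchSwap]
    by_cases H : ∀ y, r < y → h.1 y = f.1 y
    · rw [if_pos H, if_pos ((hcond r le_rfl).mp H)]
      exact fun hc => hr ((Equiv.swap _ _).injective hc)
    · rwa [if_neg H, if_neg (mt (hcond r le_rfl).mpr H)]
  · change branchSwap f.1 g.1 h.1 y = branchSwap f.1 g.1 k.1 y
    rw [branchSwap, branchSwap, hr' y hy, if_congr (hcond y hy.le) rfl rfl]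

theorem isHomogDist (hW : ∀ r ∈ W, 0 < r) (hβ : Ordinal.IsPrincipal (· + ·) β) (hβ1 : 1 < β) :
    IsHomogDist (hahnDist (z := z) (β := β)) :=
  (isUltraDist hW).isHomogDist_of_transitive (exists_isometry_apply_eq hβ hβ1)

open Classical in
/-- Change the value of `f` at `r` to `c`. -/
noncomputable def update (hβ : Ordinal.IsPrincipal (· + ·) β) (hβ1 : 1 < β)
    (f : HahnSpace z β) (r : W) (c : S r) : HahnSpace z β :=
  ⟨Function.update f.1 r c, by
    refine HasRankBelow.of_above_below hβ hβ1 r (f.2.mono ?_) (f.2.mono ?_) <;>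
    · rintro x ⟨hx, hxr⟩
      rwa [Set.mem_ofPred_eq, Function.update_of_ne (by rintro rfl; exact lt_irrefl _ hxr)] at hx⟩

section Update

variable (hβ : Ordinal.IsPrincipal (· + ·) β) (hβ1 : 1 < β)

theorem update_apply_self (f : HahnSpace z β) (r : W) (c : S r) :
    (update hβ hβ1 f r c).1 r = c := by
  simp [update]

theorem update_apply_of_ne (f : HahnSpace z β) {r y : W} (c : S r) (h : y ≠ r) :
    (update hβ hβ1 f r c).1 y = f.1 y := by
  simp [update, h]

theorem dist_update (f : HahnSpace z β) {r : W} {c : S r} (h : f.1 r ≠ c) :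
    hahnDist f (update hβ hβ1 f r c) = r :=
  dist_eq_of_largest_ne (by rwa [update_apply_self]) fun y hy => by
    rw [update_apply_of_ne hβ hβ1 f c hy.ne']

end Update

theorem specOf_eq (hβ : Ordinal.IsPrincipal (· + ·) β) (hβ1 : 1 < β)
    (hS : ∀ r, Nontrivial (S r)) :
    specOf (hahnDist (z := z) (β := β)) = insert 0 W := by
  let o : HahnSpace z β := ⟨z, by simpa using hasRankBelow_empty (zero_lt_one.trans hβ1)⟩
  ext t
  constructor
  · rintro ⟨f, g, rfl⟩
    rcases eq_or_ne f g with rfl | hne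
    · exact Or.inl (dist_self f)
    · obtain ⟨r, hr, hr'⟩ := exists_largest_ne hne
      rw [dist_eq_of_largest_ne hr hr']
      exact Or.inr r.2
  · rintro (rfl | ht)
    · exact ⟨o, o, dist_self o⟩
    · obtain ⟨c, hc⟩ := exists_ne (z ⟨t, ht⟩)
      exact ⟨o, _, dist_update hβ hβ1 o (r := ⟨t, ht⟩) (c := c) hc.symm⟩

theorem diamOf_cballOf (hW : ∀ r ∈ W, 0 < r) (a x : HahnSpace z β) :
    diamOf hahnDist (cballOf hahnDist a (hahnDist a x)) = hahnDist a x := by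
  obtain ⟨-, -, hs, hp, ht⟩ := isUltraDist (z := z) (β := β) hW
  refine IsGreatest.csSup_eq ⟨⟨a, ?_, x, le_refl (hahnDist a x), rfl⟩, ?_⟩
  · exact (dist_self a).trans_le (hp _ _)
  · rintro _ ⟨f, hf, g, hg, rfl⟩
    refine (ht f a g).trans (max_le ?_ hg)
    rw [hs]
    exact hf

theorem mk_sonsOf (hW : ∀ r ∈ W, 0 < r) (hβ : Ordinal.IsPrincipal (· + ·) β) (hβ1 : 1 < β)
    {B : Set (HahnSpace z β)} (hB : B ∈ nervOf hahnDist) (r : W) (hr : diamOf hahnDist B = r) :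
    Cardinal.mk (sonsOf hahnDist B) = Cardinal.mk (S r) := by
  obtain ⟨a, ρ, ⟨x, rfl⟩, rfl⟩ := hB
  have hx : hahnDist a x = r := by rw [← hr, diamOf_cballOf hW]
  have hr0 := hW r r.2
  obtain ⟨-, -, hs, -, ht⟩ := isUltraDist (z := z) (β := β) hW
  have ball_congr : ∀ f g : HahnSpace z β, hahnDist f g < r →
      ballOf hahnDist f r = ballOf hahnDist g r := by
    intro f g h
    ext k
    exact ⟨fun hk => (ht g f k).trans_lt (max_lt (hs f g ▸ h) hk),
      fun hk => (ht f g k).trans_lt (max_lt h hk)⟩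
  symm
  refine Cardinal.mk_congr (Equiv.ofBijective
    (fun c => ⟨ballOf hahnDist (update hβ hβ1 a r c) r, ⟨_, by rw [hr]⟩, ?_⟩) ⟨?_, ?_⟩)
  · intro k hk
    change hahnDist a k ≤ hahnDist a x
    rw [hx]
    refine (ht a (update hβ hβ1 a r c) k).trans (max_le ?_ (le_of_lt hk))
    exact (dist_le_iff hr0.le).mpr fun y hy =>
      (update_apply_of_ne hβ hβ1 a c (Subtype.coe_lt_coe.mp hy).ne').symm
  · intro c c' h
    have h' : ballOf hahnDist (update hβ hβ1 a r c) r = ballOf hahnDist (update hβ hβ1 a r c') r :=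
      congrArg Subtype.val h
    have hmem : update hβ hβ1 a r c ∈ ballOf hahnDist (update hβ hβ1 a r c') r := by
      rw [← h']
      exact (dist_self _).trans_lt hr0
    have := (dist_lt_iff hr0).mp hmem r le_rfl
    rwa [update_apply_self, update_apply_self, eq_comm] at this
  · rintro ⟨_, ⟨b, rfl⟩, hb⟩
    refine ⟨b.1 r, Subtype.ext ?_⟩
    change ballOf hahnDist _ (r : ℝ) = ballOf hahnDist b _
    rw [hr] at hb ⊢
    have hab : hahnDist a b ≤ r := hx ▸ hb ((dist_self b).trans_lt hr0)
    refine ball_congr _ _ ((dist_lt_iff hr0).mpr fun y hy => ?_)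
    rcases eq_or_lt_of_le (show r ≤ y from hy) with rfl | hlt
    · rw [update_apply_self]
    · rw [update_apply_of_ne hβ hβ1 a _ hlt.ne']
      exact (dist_le_iff hr0.le).mp hab y (Subtype.coe_lt_coe.mpr hlt)

theorem exists_isometric_embedding {β' : Ordinal.{0}} (h : β ≤ β') :
    ∃ i : HahnSpace z β → HahnSpace z β', ∀ x y, hahnDist (i x) (i y) = hahnDist x y :=
  ⟨fun f => ⟨f.1, f.2.mono_ordinal h⟩, fun _ _ => rfl⟩

/-- If all functions supported on `A` belong to a Hahn space, then some function in the image of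
any isometric embedding of this space is nowhere trivial on `A`. -/
theorem hasRankBelow_of_isometric_embedding {β' : Ordinal.{0}} (hW : ∀ r ∈ W, 0 < r)
    (hS : ∀ r, Nontrivial (S r)) {A : Set W} (hA : HasRankBelow β' A)
    (i : HahnSpace z β' → HahnSpace z β) (hi : ∀ x y, hahnDist (i x) (i y) = hahnDist x y) :
    HasRankBelow β A := by
  classical
  choose o ho using fun r => exists_ne (z r)
  let G : Set W → HahnSpace z β' := fun T => ⟨fun r => if r ∈ T ∩ A then o r else z r,
    hA.mono fun r hr => by
      by_contra hc
      exact hr (if_neg fun h => hc h.2)⟩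
  have hG : ∀ T r, (G T).1 r = if r ∈ T ∩ A then o r else z r := fun _ _ => rfl
  have hwf : WellFounded fun y x : W => y ∈ A ∧ x ∈ A ∧ x < y := by
    obtain ⟨θ, -, ρ, -, hρ⟩ := hA
    refine Subrelation.wf (r := InvImage (· < ·) ρ) ?_ (InvImage.wf _ wellFounded_lt)
    rintro x y ⟨hx, hy, h⟩
    exact hρ hy hx h
  obtain ⟨T, hT⟩ : ∃ T : Set W, ∀ r, r ∈ T ↔
      (i (G {y | ∃ _ : y ∈ A ∧ r ∈ A ∧ r < y, y ∈ T})).1 r = z r :=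
    ⟨{r | hwf.fix (C := fun _ => Prop)
      (fun r rec => (i (G {y | ∃ h : y ∈ A ∧ r ∈ A ∧ r < y, rec y h})).1 r = z r) r},
      fun r => iff_of_eq (hwf.fix_eq _ r)⟩
  refine (i (G T)).2.mono fun r hr => ?_
  set T' : Set W := {y | ∃ _ : y ∈ A ∧ r ∈ A ∧ r < y, y ∈ T}
  have hr0 := hW r r.2
  have above : ∀ y, r < y → (y ∈ T' ∩ A ↔ y ∈ T ∩ A) := fun y hy =>
    ⟨fun h => ⟨h.1.2, h.2⟩, fun h => ⟨⟨⟨h.2, hr, hy⟩, h.1⟩, h.2⟩⟩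
  have hrT' : r ∉ T' ∩ A := fun h => lt_irrefl r h.1.1.2.2
  by_cases hrT : r ∈ T
  · have hz := (hT r).mp hrT
    have hd : hahnDist (i (G T')) (i (G T)) = r := by
      rw [hi]
      refine dist_eq_of_largest_ne ?_ fun y hy => ?_
      · rw [hG, hG, if_neg hrT', if_pos ⟨hrT, hr⟩]
        exact (ho r).symm
      · simp only [hG, above y hy]
    intro hc
    refine hd.not_lt ((dist_lt_iff hr0).mpr fun y hy => ?_)
    rcases eq_or_lt_of_le (show r ≤ y from hy) with rfl | hlt
    · exact hz.trans hc.symm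
    · exact (dist_le_iff hr0.le).mp hd.le y (Subtype.coe_lt_coe.mpr hlt)
  · have hz := mt (hT r).mpr hrT
    have hd : hahnDist (i (G T')) (i (G T)) < r := by
      rw [hi]
      refine (dist_lt_iff hr0).mpr fun y hy => ?_
      rcases eq_or_lt_of_le (show r ≤ y from hy) with rfl | hlt
      · rw [hG, hG, if_neg hrT', if_neg fun h => hrT h.1]
      · simp only [hG, above y hlt]
    exact fun hc => hz (((dist_lt_iff hr0).mp hd r le_rfl).trans hc)

end HahnSpace

end HahnSpace

theorem exists_strictAnti_of_lt_omega_one {X : Type*} [LinearOrder X] [DenselyOrdered X]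
    [Nontrivial X] {α : Ordinal.{0}} (hα : α < (Cardinal.aleph 1).ord) :
    ∃ e : Set.Iio α → X, StrictAnti e := by
  have hc : Countable (Set.Iio α)ᵒᵈ := by
    have : Cardinal.mk (Set.Iio α) ≤ Cardinal.aleph0 := by
      rw [Cardinal.mk_Iio_ordinal, Cardinal.lift_le_aleph0, ← Order.lt_succ_iff,
        ← Cardinal.aleph_zero, Cardinal.succ_aleph, zero_add]
      exact Cardinal.lt_ord.mp hα
    exact Cardinal.mk_le_aleph0_iff.mp this
  obtain ⟨e⟩ := Order.embedding_from_countable_to_dense (α := (Set.Iio α)ᵒᵈ) (β := X)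
  exact ⟨fun ξ => e (OrderDual.toDual ξ),
    fun ξ η h => e.strictMono (OrderDual.toDual_lt_toDual.mpr h)⟩

/-- Let `V ⊆ ℝ⁺` contain `ℚ⁺` and let `s` assign to each `r ∈ V*` a
cardinal `s r ≥ 2`.  Then there is an `ω₁`-indexed family of homogeneous ultrametric
spaces, each with spectrum `V` and degree sequence `s`, which is strictly increasing
under isometric embeddability. -/
theorem stmt7 (V : Set ℝ) (hV : V ⊆ {r : ℝ | 0 ≤ r})
    (hQ : ∀ q : ℚ, 0 ≤ q → (q : ℝ) ∈ V)
    (s : ℝ → Cardinal.{0}) (hs : ∀ r ∈ V \ {0}, 2 ≤ s r) :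
    ∃ (P : Ordinal.{0} → Type 1) (d : ∀ γ, P γ → P γ → ℝ),
      (∀ γ < (Cardinal.aleph 1).ord,
        IsUltraDist (d γ) ∧ IsHomogDist (d γ) ∧ specOf (d γ) = V ∧
          (∀ r ∈ V \ {0}, ∀ B ∈ nervOf (d γ), diamOf (d γ) B = r →
            Cardinal.mk (sonsOf (d γ) B) = Cardinal.lift.{1} (s r))) ∧
      (∀ γ < (Cardinal.aleph 1).ord, ∀ γ' < (Cardinal.aleph 1).ord, γ < γ' →
        (∃ f : P γ → P γ', ∀ x y, d γ' (f x) (f y) = d γ x y) ∧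
          ¬(∃ f : P γ' → P γ, ∀ x y, d γ (f x) (f y) = d γ' x y)) := by
  have hW : ∀ r ∈ V \ {0}, 0 < r := fun r hr => lt_of_le_of_ne (hV hr.1) (Ne.symm hr.2)
  let S : (V \ {0} : Set ℝ) → Type 1 := fun r => ULift.{1} (s r).out
  have hcard : ∀ r, Cardinal.mk (S r) = Cardinal.lift.{1} (s r) := fun r => by
    rw [Cardinal.mk_uLift, Cardinal.mk_out]
  have hS : ∀ r, Nontrivial (S r) := fun r => by
    rw [← Cardinal.one_lt_iff_nontrivial, hcard, Cardinal.one_lt_lift_iff]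
    exact Cardinal.one_lt_two.trans_le (hs r r.2)
  let z : ∀ r, S r := fun r => (hS r).to_nonempty.some
  let b : Ordinal.{0} → Ordinal.{0} := fun γ => Ordinal.omega0 ^ (γ + 1)
  have hb : StrictMono b := fun γ γ' h =>
    (Ordinal.opow_lt_opow_iff_right Ordinal.one_lt_omega0).mpr (by simpa using h)
  have hprin : ∀ γ, Ordinal.IsPrincipal (· + ·) (b γ) := fun γ =>
    Ordinal.isPrincipal_add_omega0_opow _
  have hb1 : ∀ γ, 1 < b γ := fun γ => by
    have := (Ordinal.opow_lt_opow_iff_right Ordinal.one_lt_omega0).mpr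
      (show 0 < γ + 1 by simp)
    rwa [Ordinal.opow_zero] at this
  have hbω : ∀ γ < (Cardinal.aleph 1).ord, b γ < (Cardinal.aleph 1).ord := by
    intro γ hγ
    have hω : Ordinal.omega0 < (Cardinal.aleph 1).ord := by
      simp
    refine Ordinal.isPrincipal_opow_ord (Cardinal.aleph0_le_aleph 1) hω ?_
    exact Ordinal.isPrincipal_add_ord (Cardinal.aleph0_le_aleph 1) hγ
      (Ordinal.one_lt_omega0.trans hω)
  refine ⟨fun γ => HahnSpace z (b γ), fun γ => hahnDist, fun γ _ => ⟨HahnSpace.isUltraDist hW,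
    HahnSpace.isHomogDist hW (hprin γ) (hb1 γ), ?_, fun r hr B hB hBr => ?_⟩,
    fun γ hγ γ' hγ' h => ⟨HahnSpace.exists_isometric_embedding (hb h).le, ?_⟩⟩
  · rw [HahnSpace.specOf_eq (hprin γ) (hb1 γ) hS, Set.insert_sdiff_singleton,
      Set.insert_eq_of_mem (by simpa using hQ 0 le_rfl)]
  · rw [HahnSpace.mk_sonsOf hW (hprin γ) (hb1 γ) hB ⟨r, hr⟩ hBr, hcard]
  · rintro ⟨f, hf⟩
    obtain ⟨e, he⟩ := exists_strictAnti_of_lt_omega_one (X := Set.Ioi (0 : ℚ)) (hbω γ hγ)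
    let e' : Set.Iio (b γ) → (V \ {0} : Set ℝ) := fun ξ =>
      ⟨(e ξ : ℚ), hQ _ (e ξ).2.le, by simpa using (e ξ).2.ne'⟩
    have he' : StrictAnti e' := fun ξ η h => by
      change ((e η : ℚ) : ℝ) < ((e ξ : ℚ) : ℝ)
      exact_mod_cast he h
    exact not_hasRankBelow_range he' (HahnSpace.hasRankBelow_of_isometric_embedding hW hS
      (hasRankBelow_range (hb h) he') f hf)
end

section
/- Let M be an ultrametric space and X a topologically dense subset of M. Then Spec(M,x) = Spec(M↾X, x) ∪ {0} for every x ∈ M; in particular Spec(M↾X, x) = Spec(M,x) for every x ∈ X, and Spec(M↾X) = Spec(M). -/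
variable {M : Type*} [MetricSpace M]

/-- The spectrum of a point `a` relative to a subset `X`: the distances from `a` to
points of `X`. -/
def specAtIn (X : Set M) (a : M) : Set ℝ := {r | ∃ y ∈ X, dist a y = r}

/-- The spectrum of a point `a`: the set of distances from `a` to points of the space. -/
def specAt (a : M) : Set ℝ := Set.range (dist a)

/-- The spectrum of the subspace induced on `X`. -/
def specIn (X : Set M) : Set ℝ := {r | ∃ x ∈ X, ∃ y ∈ X, dist x y = r}

variable (M) in
/-- The spectrum of the whole space. -/
def specSet : Set ℝ := {r | ∃ x y : M, dist x y = r}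

/-- In an ultrametric space, distinct points `x`, `y` admit a point `z` of any dense set with
`dist x z = dist x y`. -/
theorem Dense.exists_mem_dist_eq_of_ne
    (ultra : ∀ x y z : M, dist x z ≤ max (dist x y) (dist y z))
    {X : Set M} (hX : Dense X) {x y : M} (hxy : x ≠ y) :
    ∃ z ∈ X, dist x z = dist x y := by
  obtain ⟨z, hz, hyz⟩ := hX.exists_dist_lt y (dist_pos.2 hxy)
  refine ⟨z, hz, le_antisymm ((ultra x y z).trans (max_le le_rfl hyz.le)) ?_⟩
  exact (le_max_iff.1 (ultra x z y)).resolve_right (by rw [dist_comm z y]; exact hyz.not_ge)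

/-- Let `M` be an ultrametric space and `X` a topologically dense subset
of `M`.  Then `Spec(M, x) = Spec(M↾X, x) ∪ {0}` for every `x ∈ M`; in particular
`Spec(M↾X, x) = Spec(M, x)` for every `x ∈ X`, and `Spec(M↾X) = Spec(M)`. -/
theorem stmt8
    (ultra : ∀ x y z : M, dist x z ≤ max (dist x y) (dist y z))
    (X : Set M) (hX : Dense X) :
    (∀ x : M, specAt x = specAtIn X x ∪ {0}) ∧
      (∀ x ∈ X, specAtIn X x = specAt x) ∧
      specIn X = specSet M := by
  have specAt_subset (x : M) : specAt x ⊆ specAtIn X x ∪ {0} := by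
    rintro _ ⟨y, rfl⟩
    obtain rfl | hxy := eq_or_ne x y
    · exact Or.inr (dist_self x)
    · exact Or.inl (hX.exists_mem_dist_eq_of_ne ultra hxy)
  have specAtIn_subset (x : M) : specAtIn X x ⊆ specAt x := by
    rintro _ ⟨y, -, rfl⟩
    exact ⟨y, rfl⟩
  have specAtIn_eq (x : M) (hx : x ∈ X) : specAtIn X x = specAt x := by
    refine (specAtIn_subset x).antisymm ((specAt_subset x).trans ?_)
    exact Set.union_subset le_rfl (Set.singleton_subset_iff.2 ⟨x, hx, dist_self x⟩)
  refine ⟨fun x => (specAt_subset x).antisymm ?_, specAtIn_eq, Set.Subset.antisymm ?_ ?_⟩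
  · exact Set.union_subset (specAtIn_subset x) (Set.singleton_subset_iff.2 ⟨x, dist_self x⟩)
  · rintro _ ⟨x, -, y, -, rfl⟩
    exact ⟨x, y, rfl⟩
  · rintro _ ⟨x, y, rfl⟩
    obtain rfl | hxy := eq_or_ne x y
    · obtain ⟨z, hz⟩ := hX.nonempty_iff.2 ⟨x⟩
      exact ⟨z, hz, z, hz, by simp⟩
    · obtain ⟨z, hz, hxz⟩ := hX.exists_mem_dist_eq_of_ne ultra hxy
      have hzx : dist z x ∈ specAtIn X z := specAtIn_eq z hz ▸ ⟨x, rfl⟩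
      rw [← hxz, dist_comm]
      exact ⟨z, hz, hzx⟩
end

section
/- The Cauchy completion of a homogeneous ultrametric space is a homogeneous (ultrametric) space. -/
open Filter Topology Metric

/-- In an ultrametric triangle, the two longer sides are equal. -/
theorem IsUltrametricDist.dist_eq_of_dist_lt {X : Type*} [PseudoMetricSpace X]
    [IsUltrametricDist X] {x y z : X} (h : dist x y < dist y z) : dist x z = dist y z := by
  rw [IsUltrametricDist.dist_eq_max_of_dist_ne_dist x y z h.ne, max_eq_right h.le]

/-- Moving two points by less than their distance does not change that distance. -/
theorem IsUltrametricDist.dist_eq_of_dist_lt_of_dist_lt {X : Type*} [PseudoMetricSpace X]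
    [IsUltrametricDist X] {x x' y y' : X} (hx : dist x' x < dist x y)
    (hy : dist y' y < dist x y) : dist x' y' = dist x y := by
  have h : dist x' y = dist x y := dist_eq_of_dist_lt hx
  rw [dist_comm, ← h, dist_comm x' y]
  apply dist_eq_of_dist_lt
  rwa [dist_comm y x', h]

/-- The strong triangle inequality passes from a dense isometric subspace to the whole space. -/
theorem Isometry.isUltrametricDist_of_denseRange {M N : Type*} [PseudoMetricSpace M]
    [PseudoMetricSpace N] [IsUltrametricDist M] {i : M → N} (hi : Isometry i)
    (hdense : DenseRange i) : IsUltrametricDist N where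
  dist_triangle_max x y z := by
    refine hdense.induction_on₃ (p := fun x y z => dist x z ≤ max (dist x y) (dist y z))
      (isClosed_le (by fun_prop) (by fun_prop)) (fun a b c => ?_) x y z
    simpa only [hi.dist_eq] using IsUltrametricDist.dist_triangle_max a b c

/-- A self-isometry of a dense subspace extends to a complete space. -/
theorem IsometryEquiv.exists_extend_of_denseRange {M N : Type*} [MetricSpace M] [MetricSpace N]
    [CompleteSpace N] {i : M → N} (hi : Isometry i) (hdense : DenseRange i) (ψ : M ≃ᵢ M) :
    ∃ g : N ≃ᵢ N, ∀ m, g (i m) = i (ψ m) := by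
  have hf : UniformContinuous (i ∘ ψ) := (hi.comp ψ.isometry).uniformContinuous
  let e : N → N := (hi.isUniformInducing.isDenseInducing hdense).extend (i ∘ ψ)
  have hec : Continuous e :=
    (uniformContinuous_uniformly_extend hi.isUniformInducing hdense hf).continuous
  have hei : ∀ m, e (i m) = i (ψ m) := uniformly_extend_of_ind hi.isUniformInducing hdense hf
  have he : Isometry e := Isometry.of_dist_eq fun x y => by
    refine hdense.induction_on₂ (p := fun x y => dist (e x) (e y) = dist x y)
      (isClosed_eq (by fun_prop) (by fun_prop)) (fun a b => ?_) x y
    rw [hei, hei, hi.dist_eq, ψ.dist_eq, hi.dist_eq]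
  have hsurj : Function.Surjective e := by
    intro y
    refine hdense.induction_on (p := fun y => y ∈ Set.range e) y
      he.isClosedEmbedding.isClosed_range fun a => ⟨i (ψ.symm a), ?_⟩
    rw [hei, ψ.apply_symm_apply]
  exact ⟨⟨Equiv.ofBijective e ⟨he.injective, hsurj⟩, he⟩, hei⟩

/-- A positive number below all the nonzero distances of a finite set. -/
theorem Set.Finite.exists_pos_lt_dist {X : Type*} [MetricSpace X] {F : Set X} (hF : F.Finite)
    {ε : ℝ} (hε : 0 < ε) :
    ∃ δ, 0 < δ ∧ δ < ε ∧ ∀ x ∈ F, ∀ y ∈ F, x ≠ y → δ < dist x y := by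
  have h : ∀ᶠ δ in 𝓝[>] (0 : ℝ), ∀ x ∈ F, ∀ y ∈ F, x ≠ y → δ < dist x y := by
    refine (eventually_all_finite hF).2 fun x _ => (eventually_all_finite hF).2 fun y _ => ?_
    by_cases hxy : x = y
    · simp [hxy]
    · filter_upwards [Ioo_mem_nhdsGT (dist_pos.2 hxy)] with δ hδ _ using hδ.2
  obtain ⟨δ, h, hδ⟩ := (h.and (Ioo_mem_nhdsGT hε)).exists
  exact ⟨δ, hδ.1, hδ.2, h⟩

/-- If a dense isometric subspace is homogeneous, then every finite partial isometry of the
ambient complete ultrametric space is approximated by global isometries. -/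
theorem IsHomogeneous.exists_isometryEquiv_dist_lt {M N : Type*} [MetricSpace M] [MetricSpace N]
    [CompleteSpace N] [IsUltrametricDist N] (hom : IsHomogeneous M) {i : M → N}
    (hi : Isometry i) (hdense : DenseRange i) {F : Set N} (hF : F.Finite) {φ : N → N}
    (hφ : ∀ x ∈ F, ∀ y ∈ F, dist (φ x) (φ y) = dist x y) {ε : ℝ} (hε : 0 < ε) :
    ∃ g : N ≃ᵢ N, ∀ x ∈ F, dist (g x) (φ x) < ε := by
  obtain ⟨δ, hδ, hδε, hsep⟩ := hF.exists_pos_lt_dist hε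
  choose a ha using fun x : N => hdense.exists_dist_lt x hδ
  simp only [dist_comm _ (i _)] at ha
  have hdist : ∀ x y, δ < dist x y → dist (a x) (a y) = dist x y := fun x y h => by
    rw [← hi.dist_eq]
    exact IsUltrametricDist.dist_eq_of_dist_lt_of_dist_lt ((ha x).trans h) ((ha y).trans h)
  have hdistF : ∀ x ∈ F, ∀ y ∈ F, dist (a x) (a y) = dist x y := fun x hx y hy => by
    by_cases hxy : x = y
    · simp [hxy]
    · exact hdist x y (hsep x hx y hy hxy)
  have hdistφ : ∀ x ∈ F, ∀ y ∈ F, dist (a (φ x)) (a (φ y)) = dist x y := fun x hx y hy => by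
    by_cases hxy : x = y
    · simp [hxy]
    · rw [hdist _ _ (by rw [hφ x hx y hy]; exact hsep x hx y hy hxy), hφ x hx y hy]
  have hinj : Set.InjOn a F := fun x hx y hy h => by
    rw [← dist_eq_zero, ← hdistF x hx y hy, h, dist_self]
  cases isEmpty_or_nonempty N
  · exact ⟨.refl N, fun x => isEmptyElim x⟩
  have hinv : ∀ x ∈ F, Function.invFunOn a F (a x) = x := fun x hx =>
    hinj.leftInvOn_invFunOn hx
  obtain ⟨ψ, hψ⟩ := hom (a '' F) (hF.image a) (fun m => a (φ (Function.invFunOn a F m))) (by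
    rintro _ ⟨x, hx, rfl⟩ _ ⟨y, hy, rfl⟩
    rw [hinv x hx, hinv y hy, hdistφ x hx y hy, hdistF x hx y hy])
  obtain ⟨g, hg⟩ := IsometryEquiv.exists_extend_of_denseRange hi hdense ψ
  refine ⟨g, fun x hx => ?_⟩
  have hgx : g (i (a x)) = i (a (φ x)) := by
    rw [hg, hψ _ (Set.mem_image_of_mem a hx), hinv x hx]
  refine (dist_triangle_max (g x) (g (i (a x))) (φ x)).trans_lt (max_lt ?_ ?_)
  · rw [g.dist_eq, dist_comm]
    exact (ha x).trans hδε
  · rw [hgx]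
    exact (ha (φ x)).trans hδε

/-- In an ultrametric space, a finite partial isometry which is approximated by global
isometries extends to a global isometry: apply to each point outside the finite set an
approximation finer than its distance to that set. -/
theorem IsUltrametricDist.exists_isometryEquiv_extend {N : Type*} [MetricSpace N]
    [IsUltrametricDist N] {F : Set N} (hF : F.Finite) {φ : N → N}
    (hφ : ∀ x ∈ F, ∀ y ∈ F, dist (φ x) (φ y) = dist x y)
    (happrox : ∀ ε > 0, ∃ g : N ≃ᵢ N, ∀ x ∈ F, dist (g x) (φ x) < ε) :
    ∃ ψ : N ≃ᵢ N, ∀ x ∈ F, ψ x = φ x := by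
  classical
  obtain rfl | hne := F.eq_empty_or_nonempty
  · exact ⟨.refl N, by simp⟩
  choose! g hg using happrox
  let θ : N → N := fun z => if z ∈ F then φ z else g (infDist z F) z
  have hθF : ∀ z ∈ F, θ z = φ z := fun z hz => if_pos hz
  have hθ : ∀ z ∉ F, θ z = g (infDist z F) z := fun z hz => if_neg hz
  have hpos : ∀ z ∉ F, 0 < infDist z F := fun z hz =>
    (hF.isClosed.notMem_iff_infDist_pos hne).1 hz
  have hθdist : ∀ z, ∀ x ∈ F, dist (θ z) (φ x) = dist z x := by
    intro z x hx
    by_cases hz : z ∈ F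
    · rw [hθF z hz, hφ z hz x hx]
    · have hle := infDist_le_dist_of_mem (x := z) hx
      have hlt := hg _ (hpos z hz) x hx
      rw [hθ z hz, dist_comm, ← (g (infDist z F)).dist_eq z x,
        dist_comm (g (infDist z F) z)]
      apply dist_eq_of_dist_lt
      rw [dist_comm, (g (infDist z F)).dist_eq, dist_comm x z]
      exact hlt.trans_le hle
  have hlt : ∀ z w, infDist z F < infDist w F → dist (θ z) (θ w) = dist z w := by
    intro z w h
    obtain ⟨x, hx, hzx⟩ := hF.isCompact.exists_infDist_eq_dist hne z
    have hzw : dist z x < dist x w := by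
      rw [← hzx, dist_comm]
      exact h.trans_le (infDist_le_dist_of_mem hx)
    rw [dist_eq_of_dist_lt hzw, dist_eq_of_dist_lt (y := φ x), dist_comm, hθdist w x hx,
      dist_comm]
    rwa [hθdist z x hx, dist_comm (φ x), hθdist w x hx, dist_comm w]
  have hiso : Isometry θ := Isometry.of_dist_eq fun z w => by
    obtain h | h | h := lt_trichotomy (infDist z F) (infDist w F)
    · exact hlt z w h
    · by_cases hz : z ∈ F
      · rw [hθF z hz, dist_comm, hθdist w z hz, dist_comm]
      by_cases hw : w ∈ F
      · rw [hθF w hw, hθdist z w hw]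
      rw [hθ z hz, hθ w hw, h, (g _).dist_eq]
    · rw [dist_comm, hlt w z h, dist_comm]
  have hsurj : Function.Surjective θ := by
    intro v
    by_cases hv : v ∈ φ '' F
    · obtain ⟨x, hx, rfl⟩ := hv
      exact ⟨x, hθF x hx⟩
    have hs : 0 < infDist v (φ '' F) :=
      ((hF.image φ).isClosed.notMem_iff_infDist_pos (hne.image φ)).1 hv
    set s := infDist v (φ '' F)
    have hdist : ∀ x ∈ F, dist ((g s).symm v) x = dist v (φ x) := fun x hx => by
      rw [← (g s).dist_eq, (g s).apply_symm_apply, dist_comm, dist_comm v]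
      apply dist_eq_of_dist_lt
      rw [dist_comm (φ x) v]
      exact (hg s hs x hx).trans_le (infDist_le_dist_of_mem (Set.mem_image_of_mem φ hx))
    have hinf : infDist ((g s).symm v) F = s := by
      apply le_antisymm
      · obtain ⟨_, ⟨x, hx, rfl⟩, hvx⟩ :=
          (hF.image φ).isCompact.exists_infDist_eq_dist (hne.image φ) v
        exact (infDist_le_dist_of_mem hx).trans_eq ((hdist x hx).trans hvx.symm)
      · obtain ⟨x, hx, hvx⟩ := hF.isCompact.exists_infDist_eq_dist hne ((g s).symm v)
        rw [hvx, hdist x hx]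
        exact infDist_le_dist_of_mem (Set.mem_image_of_mem φ hx)
    have hmem : (g s).symm v ∉ F :=
      (hF.isClosed.notMem_iff_infDist_pos hne).2 (hs.trans_eq hinf.symm)
    exact ⟨(g s).symm v, by rw [hθ _ hmem, hinf, (g s).apply_symm_apply]⟩
  exact ⟨⟨Equiv.ofBijective θ ⟨hiso.injective, hsurj⟩, hiso⟩, hθF⟩

/-- The Cauchy completion of a homogeneous ultrametric space is a
homogeneous (ultrametric) space.  Here the Cauchy completion of `M` is any complete
metric space `N` containing `M` as a dense isometric subspace. -/
theorem stmt17 {M N : Type*} [MetricSpace M] [MetricSpace N] [CompleteSpace N]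
    (ultra : ∀ x y z : M, dist x z ≤ max (dist x y) (dist y z))
    (i : M → N) (hi : Isometry i) (hdense : DenseRange i)
    (hom : IsHomogeneous M) :
    IsHomogeneous N ∧ (∀ x y z : N, dist x z ≤ max (dist x y) (dist y z)) := by
  have : IsUltrametricDist M := ⟨ultra⟩
  have : IsUltrametricDist N := hi.isUltrametricDist_of_denseRange hdense
  exact ⟨fun F hF φ hφ => IsUltrametricDist.exists_isometryEquiv_extend hF hφ fun ε hε =>
    hom.exists_isometryEquiv_dist_lt hi hdense hF hφ hε, dist_triangle_max⟩
end

section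
/- In an ultrametric space M: (1) the strong modules of M are exactly the balls of M (the open balls B(a,r) and closed balls B̂(a,r) for a ∈ M, r ≥ 0) together with M itself; (2) the robust modules of M are exactly the closed balls attaining their diameter, i.e., the sets of the form B̂(a, d(a,b)) for a, b ∈ M. -/
section Defs

variable {M : Type*} [MetricSpace M]

/-- A subset `A` is a module if points outside `A` are at constant distance from `A`. -/
def IsModule (A : Set M) : Prop :=
  ∀ x ∉ A, ∀ y ∈ A, ∀ y' ∈ A, dist x y = dist x y'

/-- A module is strong if it is comparable under inclusion to every module it meets. -/
def IsStrongModule (A : Set M) : Prop :=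
  IsModule A ∧ ∀ C : Set M, IsModule C → (A ∩ C).Nonempty → A ⊆ C ∨ C ⊆ A

/-- A module is robust if it is the least strong module containing some pair of elements
of the space. -/
def IsRobustModule (A : Set M) : Prop :=
  ∃ a b : M, IsLeast {S : Set M | IsStrongModule S ∧ a ∈ S ∧ b ∈ S} A

end Defs

section Ultrametric

variable {M : Type*} [MetricSpace M]

/-- A module all of whose pairs are closer to each other than to any outside point is strong. -/
theorem IsModule.isStrongModule {A : Set M} (hA : IsModule A)
    (h : ∀ x ∈ A, ∀ y ∈ A, ∀ z ∉ A, dist x y < dist x z) : IsStrongModule A := by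
  refine ⟨hA, fun C hC ⟨x, hxA, hxC⟩ => ?_⟩
  by_contra! hn
  obtain ⟨⟨b, hbA, hbC⟩, c, hcC, hcA⟩ := hn.imp Set.not_subset.mp Set.not_subset.mp
  have h₁ := hC b hbC x hxC c hcC
  exact (h b hbA x hxA c hcA).ne h₁

variable [IsUltrametricDist M]

theorem isModule_ball (a : M) (r : ℝ) : IsModule (Metric.ball a r) := by
  intro x hx y hy z hz
  have h₁ := dist_triangle_max x y a
  have h₂ := dist_triangle_max x z a
  have h₃ := dist_triangle_max x a y
  have h₄ := dist_triangle_max x a z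
  simp only [Metric.mem_ball, dist_comm a] at *
  grind

theorem isModule_closedBall (a : M) (r : ℝ) : IsModule (Metric.closedBall a r) := by
  intro x hx y hy z hz
  have h₁ := dist_triangle_max x y a
  have h₂ := dist_triangle_max x z a
  have h₃ := dist_triangle_max x a y
  have h₄ := dist_triangle_max x a z
  simp only [Metric.mem_closedBall, dist_comm a] at *
  grind

theorem isStrongModule_ball (a : M) (r : ℝ) : IsStrongModule (Metric.ball a r) := by
  refine (isModule_ball a r).isStrongModule fun x hx y hy z hz => ?_
  rw [IsUltrametricDist.ball_eq_of_mem hx] at hy hz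
  rw [Metric.mem_ball'] at hy hz
  exact hy.trans_le (not_lt.mp hz)

theorem isStrongModule_closedBall (a : M) (r : ℝ) :
    IsStrongModule (Metric.closedBall a r) := by
  refine (isModule_closedBall a r).isStrongModule fun x hx y hy z hz => ?_
  rw [IsUltrametricDist.closedBall_eq_of_mem hx] at hy hz
  rw [Metric.mem_closedBall'] at hy hz
  exact hy.trans_lt (not_le.mp hz)

theorem isModule_ball_union_ball (a x : M) :
    IsModule (Metric.ball a (dist a x) ∪ Metric.ball x (dist a x)) := by
  intro y hy
  have hya : y ∉ Metric.ball a (dist a x) := fun h => hy (Or.inl h)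
  have hyx : y ∉ Metric.ball x (dist a x) := fun h => hy (Or.inr h)
  have key : dist y a = dist y x := by
    have h₁ := dist_triangle_max y a x
    have h₂ := dist_triangle_max y x a
    rw [dist_comm x a] at h₂
    rw [Metric.mem_ball, not_lt] at hya hyx
    grind
  have eq_center : ∀ z ∈ Metric.ball a (dist a x) ∪ Metric.ball x (dist a x),
      dist y z = dist y a := by
    rintro z (hz | hz)
    · exact isModule_ball _ _ y hya z hz a
        (Metric.mem_ball_self (dist_nonneg.trans_lt (Metric.mem_ball.mp hz)))
    · exact (isModule_ball _ _ y hyx z hz x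
        (Metric.mem_ball_self (dist_nonneg.trans_lt (Metric.mem_ball.mp hz)))).trans key.symm
  intro z hz z' hz'
  rw [eq_center z hz, eq_center z' hz']

theorem IsModule.dist_le {A : Set M} (hA : IsModule A) {a b x : M} (ha : a ∈ A) (hb : b ∈ A)
    (hx : x ∉ A) : dist a b ≤ dist a x := by
  have h := dist_triangle_max a x b
  rwa [hA x hx b hb a ha, dist_comm x a, max_self] at h

theorem IsStrongModule.dist_lt {A : Set M} (hA : IsStrongModule A) {a b x : M} (ha : a ∈ A)
    (hb : b ∈ A) (hx : x ∉ A) : dist a b < dist a x := by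
  refine (hA.1.dist_le ha hb hx).lt_of_ne fun hab => ?_
  have hpos : 0 < dist a x := dist_pos.mpr fun h => hx (h ▸ ha)
  have hbx : dist b x = dist a x := by
    rw [dist_comm b, dist_comm a, hA.1 x hx b hb a ha]
  rcases hA.2 _ (isModule_ball_union_ball a x) ⟨a, ha, Or.inl (Metric.mem_ball_self hpos)⟩
    with h | h
  · rcases h hb with h | h
    · rw [Metric.mem_ball', hab] at h
      exact lt_irrefl _ h
    · rw [Metric.mem_ball, hbx] at h
      exact lt_irrefl _ h
  · exact hx (h (Or.inr (Metric.mem_ball_self hpos)))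

theorem IsStrongModule.closedBall_subset {A : Set M} (hA : IsStrongModule A) {a b : M}
    (ha : a ∈ A) (hb : b ∈ A) : Metric.closedBall a (dist a b) ⊆ A := by
  intro x hx
  by_contra hxA
  exact (hA.dist_lt ha hb hxA).not_ge (Metric.mem_closedBall'.mp hx)

theorem IsStrongModule.exists_eq_ball {A : Set M} (hA : IsStrongModule A) (hne : A ≠ Set.univ) :
    ∃ (a : M) (r : ℝ), 0 ≤ r ∧ (A = Metric.ball a r ∨ A = Metric.closedBall a r) := by
  obtain ⟨x₀, hx₀⟩ := (Set.ne_univ_iff_exists_notMem A).mp hne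
  rcases A.eq_empty_or_nonempty with rfl | ⟨a, ha⟩
  · exact ⟨x₀, 0, le_rfl, Or.inl Metric.ball_zero.symm⟩
  refine ⟨a, ?_⟩
  by_cases hmin : ∃ x ∉ A, ∀ y ∉ A, dist a x ≤ dist a y
  · obtain ⟨x, hx, hxmin⟩ := hmin
    refine ⟨dist a x, dist_nonneg, Or.inl (Set.Subset.antisymm ?_ ?_)⟩
    · exact fun b hb => Metric.mem_ball'.mpr (hA.dist_lt ha hb hx)
    · intro y hy
      by_contra hyA
      exact (hxmin y hyA).not_gt (Metric.mem_ball'.mp hy)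
  · push Not at hmin
    have hbdd : BddBelow (dist a '' Aᶜ) := ⟨0, by rintro _ ⟨y, -, rfl⟩; exact dist_nonneg⟩
    have hnonempty : (dist a '' Aᶜ).Nonempty := ⟨_, x₀, hx₀, rfl⟩
    refine ⟨sInf (dist a '' Aᶜ), ?_, Or.inr (Set.Subset.antisymm ?_ ?_)⟩
    · exact le_csInf hnonempty (by rintro _ ⟨y, -, rfl⟩; exact dist_nonneg)
    · intro b hb
      refine Metric.mem_closedBall'.mpr (le_csInf hnonempty ?_)
      rintro _ ⟨y, hy, rfl⟩
      exact hA.1.dist_le ha hb hy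
    · intro y hy
      by_contra hyA
      obtain ⟨z, hz, hlt⟩ := hmin y hyA
      exact hlt.not_ge ((Metric.mem_closedBall'.mp hy).trans (csInf_le hbdd ⟨z, hz, rfl⟩))

theorem isLeast_closedBall_dist (a b : M) :
    IsLeast {S : Set M | IsStrongModule S ∧ a ∈ S ∧ b ∈ S} (Metric.closedBall a (dist a b)) :=
  ⟨⟨isStrongModule_closedBall _ _, Metric.mem_closedBall_self dist_nonneg,
    Metric.mem_closedBall'.mpr le_rfl⟩, fun _ hS => hS.1.closedBall_subset hS.2.1 hS.2.2⟩

end Ultrametric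

/-- In an ultrametric space `M`: (1) the strong modules of `M` are
exactly the balls of `M` (open or closed, of non-negative radius) together with `M`
itself; (2) the robust modules of `M` are exactly the closed balls attaining their
diameter, i.e., the sets of the form `B̂(a, d(a,b))` for `a, b ∈ M`. -/
theorem stmt19 {M : Type*} [MetricSpace M]
    (ultra : ∀ x y z : M, dist x z ≤ max (dist x y) (dist y z)) :
    (∀ A : Set M, IsStrongModule A ↔
      ((∃ (a : M) (r : ℝ), 0 ≤ r ∧ (A = Metric.ball a r ∨ A = Metric.closedBall a r)) ∨
        A = Set.univ)) ∧
      (∀ A : Set M, IsRobustModule A ↔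
        ∃ a b : M, A = Metric.closedBall a (dist a b)) := by
  have : IsUltrametricDist M := ⟨ultra⟩
  refine ⟨fun A => ⟨fun hA => ?_, ?_⟩, fun A => ⟨?_, ?_⟩⟩
  · exact (em (A = Set.univ)).symm.imp_left hA.exists_eq_ball
  · rintro (⟨a, r, -, rfl | rfl⟩ | rfl)
    · exact isStrongModule_ball a r
    · exact isStrongModule_closedBall a r
    · exact ⟨fun x hx => absurd (Set.mem_univ x) hx, fun C _ _ => Or.inr (Set.subset_univ C)⟩
  · rintro ⟨a, b, hA⟩
    exact ⟨a, b, hA.unique (isLeast_closedBall_dist a b)⟩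
  · rintro ⟨a, b, rfl⟩
    exact ⟨a, b, isLeast_closedBall_dist a b⟩
end
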